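/- arXiv:2604.22733 — 4 statements merged into one kernel-verified Lean document; each statement's English description precedes it below -/
import Mathlib

section
/- If the characteristic polynomial of A has no repeated roots and P(A_1,…,A_n) = 0, then there exist eigenvectors v_1,…,v_n ∈ ℂⁿ, with v_i an eigenvector of A_i for each i, such that v_1,…,v_n are linearly dependent. -/
/-- The Kronecker-sum matrix `A` of `A_1, …, A_n`, with rows and columns indexed by
functions `f : Fin n → Fin n`:
`A f g = ∑ i, (A_i)_{f(i), g(i)} * ∏_{j ≠ i} [f j = g j]`. -/
noncomputable def kronSum (n : ℕ) (A : Fin n → Matrix (Fin n) (Fin n) ℂ) :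
    Matrix (Fin n → Fin n) (Fin n → Fin n) ℂ :=
  Matrix.of fun f g =>
    ∑ i : Fin n, A i (f i) (g i) *
      ∏ j ∈ Finset.univ.erase i, (if f j = g j then (1 : ℂ) else 0)

/-- The row vector `w`, indexed by functions `f : Fin n → Fin n`, with `w f = sgn f`
if `f` is a permutation and `w f = 0` otherwise. -/
noncomputable def wRow (n : ℕ) : (Fin n → Fin n) → ℂ := fun f =>
  ∑ π : Equiv.Perm (Fin n), if f = ⇑π then ((Equiv.Perm.sign π : ℤ) : ℂ) else 0

/-- The square matrix `M(A_1, …, A_n)` whose rows are `w, wA, wA², …, wA^{nⁿ-1}`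
(rows indexed by functions `Fin n → Fin n` via a bijection with `Fin (nⁿ)`). -/
noncomputable def Mbig (n : ℕ) (A : Fin n → Matrix (Fin n) (Fin n) ℂ) :
    Matrix (Fin n → Fin n) (Fin n → Fin n) ℂ :=
  Matrix.of fun f g =>
    Matrix.vecMul (wRow n) (kronSum n A ^ ((Fintype.equivFin (Fin n → Fin n)) f : ℕ)) g

/-- `P(A_1, …, A_n) = det M(A_1, …, A_n)`. -/
noncomputable def Pbig (n : ℕ) (A : Fin n → Matrix (Fin n) (Fin n) ℂ) : ℂ :=
  (Mbig n A).det

open Matrix in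
/-- The operator acting by `A i` on the `i`-th tensor factor. -/
noncomputable def slotOp (n : ℕ) (A : Fin n → Matrix (Fin n) (Fin n) ℂ) (i : Fin n)
    (u : (Fin n → Fin n) → ℂ) : (Fin n → Fin n) → ℂ := fun f =>
  ∑ a, A i (f i) a * u (Function.update f i a)

theorem kronSum_mulVec (n : ℕ) (A : Fin n → Matrix (Fin n) (Fin n) ℂ)
    (u : (Fin n → Fin n) → ℂ) :
    (kronSum n A).mulVec u = ∑ i, slotOp n A i u := by
  ext f
  simp only [Matrix.mulVec, dotProduct, kronSum, Matrix.of_apply, Finset.sum_apply, slotOp,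
    Finset.sum_mul]
  rw [Finset.sum_comm]
  refine Finset.sum_congr rfl fun i _ => ?_
  symm
  refine Finset.sum_of_injOn (fun a => Function.update f i a) ?_ (by simp) ?_ ?_
  · intro a _ b _ h
    exact Function.update_injective f i h
  · intro g _ hg
    have hne : ∃ j ∈ Finset.univ.erase i, f j ≠ g j := by
      by_contra hcon
      push Not at hcon
      apply hg
      refine ⟨g i, by simp, ?_⟩
      funext j
      by_cases hj : j = i
      · subst hj; simp
      · simp [hj, hcon j (by simp [hj])]
    obtain ⟨j, hj, hfg⟩ := hne
    rw [Finset.prod_eq_zero hj (by simp [hfg])]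
    simp
  · intro a _
    rw [Finset.prod_eq_one]
    · simp
    · intro j hj
      have : j ≠ i := by simpa using hj
      simp [this]

theorem slotOp_comm (n : ℕ) (A : Fin n → Matrix (Fin n) (Fin n) ℂ) (i j : Fin n)
    (u : (Fin n → Fin n) → ℂ) :
    slotOp n A i (slotOp n A j u) = slotOp n A j (slotOp n A i u) := by
  by_cases hij : i = j
  · subst hij; rfl
  ext f
  simp only [slotOp, Finset.mul_sum]
  rw [Finset.sum_comm]
  refine Finset.sum_congr rfl fun a _ => Finset.sum_congr rfl fun b _ => ?_
  rw [Function.update_of_ne hij, Function.update_of_ne (Ne.symm hij),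
    Function.update_comm hij]
  ring

theorem slotOp_sum (n : ℕ) (A : Fin n → Matrix (Fin n) (Fin n) ℂ) (i : Fin n)
    (u : Fin n → (Fin n → Fin n) → ℂ) :
    slotOp n A i (∑ j, u j) = ∑ j, slotOp n A i (u j) := by
  ext f
  simp only [slotOp, Finset.sum_apply, Finset.mul_sum]
  rw [Finset.sum_comm]

theorem slotOp_smul (n : ℕ) (A : Fin n → Matrix (Fin n) (Fin n) ℂ) (i : Fin n) (c : ℂ)
    (u : (Fin n → Fin n) → ℂ) :
    slotOp n A i (c • u) = c • slotOp n A i u := by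
  ext f
  simp only [slotOp, Pi.smul_apply, smul_eq_mul, Finset.mul_sum]
  exact Finset.sum_congr rfl fun a _ => by ring

theorem slotOp_pure (n : ℕ) (A : Fin n → Matrix (Fin n) (Fin n) ℂ) (v : Fin n → Fin n → ℂ)
    (μ : ℂ) (i : Fin n) (h : (A i).mulVec (v i) = μ • v i) :
    slotOp n A i (fun f => ∏ j, v j (f j)) = μ • (fun f => ∏ j, v j (f j)) := by
  ext f
  have h1 := congrFun h (f i)
  simp only [Matrix.mulVec, dotProduct, Pi.smul_apply, smul_eq_mul] at h1
  simp only [slotOp, Pi.smul_apply, smul_eq_mul]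
  have hp : ∀ a, ∏ j, v j (Function.update f i a j)
      = v i a * ∏ j ∈ Finset.univ.erase i, v j (f j) := by
    intro a
    rw [← Finset.mul_prod_erase _ _ (Finset.mem_univ i)]
    congr 1
    · simp
    · refine Finset.prod_congr rfl fun j hj => ?_
      have : j ≠ i := by simpa using hj
      simp [this]
  simp only [hp]
  rw [← Finset.mul_prod_erase _ _ (Finset.mem_univ i), ← mul_assoc, ← h1, Finset.sum_mul]
  exact Finset.sum_congr rfl fun a _ => by ring

theorem wRow_pure (n : ℕ) (v : Fin n → Fin n → ℂ) :
    wRow n ⬝ᵥ (fun f => ∏ j, v j (f j)) = (Matrix.of v).det := by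
  rw [← Matrix.det_transpose, Matrix.det_apply']
  simp only [dotProduct, wRow, Finset.sum_mul]
  rw [Finset.sum_comm]
  simp [ite_mul]

theorem eigen_unique {ι : Type*} [Fintype ι] [DecidableEq ι] (B : Matrix ι ι ℂ)
    (hsf : Squarefree B.charpoly) (lam : ℂ) (u x : ι → ℂ) (hu0 : u ≠ 0)
    (hu : B.mulVec u = lam • u) (hx : B.mulVec x = lam • x) : ∃ c : ℂ, x = c • u := by
  have hle := LinearMap.finrank_eigenspace_le (Matrix.toLin' B) lam
  rw [Matrix.charpoly_toLin'] at hle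
  have hsep := PerfectField.separable_iff_squarefree.mpr hsf
  have h1 := hle.trans (Polynomial.rootMultiplicity_le_one_of_separable hsep lam)
  obtain ⟨z, hz⟩ := finrank_le_one_iff.mp h1
  obtain ⟨a, ha⟩ := hz ⟨u, by rw [Module.End.mem_eigenspace_iff]; simpa using hu⟩
  obtain ⟨b, hb⟩ := hz ⟨x, by rw [Module.End.mem_eigenspace_iff]; simpa using hx⟩
  have ha' := congrArg Subtype.val ha
  have hb' := congrArg Subtype.val hb
  simp only [Submodule.coe_smul] at ha' hb'
  have ha0 : a ≠ 0 := by
    rintro rfl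
    exact hu0 (by rw [← ha']; simp)
  refine ⟨b / a, ?_⟩
  rw [← hb', ← ha', smul_smul, div_mul_cancel₀ _ ha0]

theorem krylov_zero {ι : Type*} [Fintype ι] [DecidableEq ι] (B : Matrix ι ι ℂ)
    (w x : ι → ℂ) (h : ∀ k < Fintype.card ι, w ⬝ᵥ (B ^ k).mulVec x = 0) (k : ℕ) :
    w ⬝ᵥ (B ^ k).mulVec x = 0 := by
  by_cases hcard : Fintype.card ι = 0
  · haveI := Fintype.card_eq_zero_iff.mp hcard
    simp [dotProduct]
  rw [Matrix.pow_eq_aeval_mod_charpoly B k,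
    Polynomial.aeval_eq_sum_range' (n := Fintype.card ι), Matrix.sum_mulVec, dotProduct_sum]
  · refine Finset.sum_eq_zero fun j hj => ?_
    rw [Matrix.smul_mulVec, dotProduct_smul, h j (Finset.mem_range.mp hj), smul_zero]
  · have := Polynomial.natDegree_modByMonic_lt (Polynomial.X ^ k) B.charpoly_monic (by
      intro h1
      have := B.charpoly_natDegree_eq_dim
      rw [h1] at this
      simp at this
      exact hcard this.symm)
    rwa [B.charpoly_natDegree_eq_dim] at this

theorem krylov_eigen {ι : Type*} [Fintype ι] [DecidableEq ι] (B : Matrix ι ι ℂ)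
    (w x : ι → ℂ) (hx : x ≠ 0) (h : ∀ k, w ⬝ᵥ (B ^ k).mulVec x = 0) :
    ∃ (lam : ℂ) (u : ι → ℂ), u ≠ 0 ∧ B.mulVec u = lam • u ∧ w ⬝ᵥ u = 0 := by
  let K : Submodule ℂ (ι → ℂ) :=
    { carrier := {y | ∀ k, w ⬝ᵥ (B ^ k).mulVec y = 0}
      add_mem' := by
        intro a b ha hb k
        rw [Matrix.mulVec_add, dotProduct_add, ha k, hb k, add_zero]
      zero_mem' := by intro k; simp
      smul_mem' := by
        intro c a ha k
        rw [Matrix.mulVec_smul, dotProduct_smul, ha k, smul_zero] }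
  have hK : ∀ y ∈ K, Matrix.toLin' B y ∈ K := by
    intro y hy k
    have := hy (k + 1)
    rwa [pow_succ, ← Matrix.mulVec_mulVec] at this
  haveI : Nontrivial K := ⟨⟨x, h⟩, 0, fun h0 => hx (congrArg Subtype.val h0)⟩
  obtain ⟨lam, hlam⟩ := Module.End.exists_eigenvalue ((Matrix.toLin' B).restrict hK)
  obtain ⟨u, hu⟩ := hlam.exists_hasEigenvector
  refine ⟨lam, u.1, fun h0 => hu.2 (Subtype.ext h0), ?_, ?_⟩
  · have := congrArg Subtype.val hu.apply_eq_smul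
    simpa using this
  · simpa using u.2 0

/-- if the characteristic polynomial of the Kronecker sum `A` has no
repeated roots (i.e. is squarefree) and `P(A_1, …, A_n) = 0`, then there are
eigenvectors `v_i` of the `A_i` that are linearly dependent. -/
theorem stmt4 (n : ℕ) (A : Fin n → Matrix (Fin n) (Fin n) ℂ)
    (hsf : Squarefree (kronSum n A).charpoly)
    (hP : Pbig n A = 0) :
    ∃ v : Fin n → Fin n → ℂ,
      (∀ i, v i ≠ 0 ∧ ∃ μ : ℂ, (A i).mulVec (v i) = μ • v i) ∧
      ¬ LinearIndependent ℂ v := by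
  obtain ⟨x, hx0, hx⟩ := Matrix.exists_mulVec_eq_zero_iff.mpr hP
  have hk : ∀ k < Fintype.card (Fin n → Fin n),
      wRow n ⬝ᵥ (kronSum n A ^ k).mulVec x = 0 := by
    intro k hk
    have := congrFun hx ((Fintype.equivFin (Fin n → Fin n)).symm ⟨k, hk⟩)
    rw [Matrix.dotProduct_mulVec]
    simpa [Mbig, Matrix.mulVec] using this
  obtain ⟨lam, u, hu0, hu, hwu⟩ := krylov_eigen _ _ x hx0 (krylov_zero _ _ x hk)
  have hslot : ∀ i, ∃ c : ℂ, slotOp n A i u = c • u := by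
    intro i
    refine eigen_unique _ hsf lam u _ hu0 hu ?_
    rw [kronSum_mulVec]
    simp_rw [slotOp_comm n A _ i]
    rw [← slotOp_sum, ← kronSum_mulVec, hu, slotOp_smul]
  choose μ hμ using hslot
  obtain ⟨f, hf⟩ := Function.ne_iff.mp hu0
  let v : Fin n → Fin n → ℂ := fun i a => u (Function.update f i a)
  have hv : ∀ i, (A i).mulVec (v i) = μ i • v i := by
    intro i
    ext a
    have := congrFun (hμ i) (Function.update f i a)
    simpa [slotOp, Matrix.mulVec, dotProduct, v] using this
  refine ⟨v, fun i => ⟨fun h0 => hf ?_, μ i, hv i⟩, fun hli => ?_⟩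
  · simpa [v] using congrFun h0 (f i)
  have hsum : lam • u = (∑ i, μ i) • u := by
    rw [← hu, kronSum_mulVec, Finset.sum_smul]
    exact Finset.sum_congr rfl fun i _ => hμ i
  have hlam : lam = ∑ i, μ i := smul_left_injective ℂ hu0 hsum
  obtain ⟨c, hc⟩ := eigen_unique _ hsf lam u (fun f => ∏ j, v j (f j)) hu0 hu (by
    rw [kronSum_mulVec, hlam, Finset.sum_smul]
    exact Finset.sum_congr rfl fun i _ => slotOp_pure n A v (μ i) i (hv i))
  have hdet := wRow_pure n v
  rw [hc, dotProduct_smul, hwu, smul_zero] at hdet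
  have hunit := (Matrix.linearIndependent_rows_iff_isUnit (A := Matrix.of v)).mp hli
  rw [Matrix.isUnit_iff_isUnit_det, ← hdet] at hunit
  exact not_isUnit_zero hunit
end

section
/- Let Q ∈ ℂ[v_1,…,v_a, x_1,…,x_b] be bihomogeneous, i.e., every monomial of Q has the same total degree in the variables v_1,…,v_a and every monomial of Q has the same total degree in the variables x_1,…,x_b. For v ∈ ℂ^a, let Q_v ∈ ℂ[x_1,…,x_b] denote the polynomial obtained from Q by substituting the coordinates of v for v_1,…,v_a. Then there exists a set S of polynomials in ℂ[v_1,…,v_a] such that for every v ∈ ℂ^a, the polynomial Q_v is not squarefree if and only if every polynomial in S vanishes at v; in other words, the set {v ∈ ℂ^a : Q_v is not squarefree} is an affine algebraic subvariety of ℂ^a. -/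
open MvPolynomial in
theorem aux_pderiv_deg {b : ℕ} (p : MvPolynomial (Fin b) ℂ) (i : Fin b)
    (h : pderiv i p ≠ 0) : (pderiv i p).totalDegree < p.totalDegree := by
  obtain ⟨m, hm, hmd⟩ := Finset.exists_mem_eq_sup (pderiv i p).support
    (by simpa [Finset.nonempty_iff_ne_empty] using h) (fun s => s.sum fun _ e => e)
  have h1 : (pderiv i p).totalDegree = m.sum fun _ e => e := hmd
  have h2 : m + Finsupp.single i 1 ∈ p.support := by
    rw [mem_support_iff, coeff_pderiv] at hm
    rw [mem_support_iff]
    intro h0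
    apply hm
    simp [h0]
  have h3 := le_totalDegree h2
  rw [Finsupp.sum_add_index' (by simp) (by simp)] at h3
  simp at h3
  omega

open MvPolynomial in
theorem aux_pderiv_zero {b : ℕ} (p : MvPolynomial (Fin b) ℂ)
    (h : ∀ i, pderiv i p = 0) : p.totalDegree = 0 := by
  rw [totalDegree_eq_zero_iff]
  intro m hm i
  by_contra hi
  have h1 : coeff (m - Finsupp.single i 1) (pderiv i p) = 0 := by rw [h i]; simp
  have h2 : m - Finsupp.single i 1 + Finsupp.single i 1 = m := by
    ext j
    by_cases hj : i = j
    · subst hj; simp; omega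
    · simp [hj]
  rw [coeff_pderiv, h2] at h1
  rw [mem_support_iff] at hm
  rcases mul_eq_zero.1 h1 with h1 | h1
  · exact hm h1
  · norm_cast at h1

theorem aux_sqf_dvd {R : Type*} [CommRing R] [IsDomain R] [UniqueFactorizationMonoid R]
    (F B : R) (hF : Squarefree F) (h0 : F ≠ 0) (h : ∀ p, Prime p → p ∣ F → p ∣ B) : F ∣ B := by
  revert hF h0 h
  induction F using UniqueFactorizationMonoid.induction_on_prime with
  | h₁ => intro _ h0; exact absurd rfl h0
  | h₂ x hx => intro _ _ _; exact hx.dvd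
  | h₃ x p hx hp ih =>
    intro hF h0 h
    obtain ⟨c, rfl⟩ := ih (hF.squarefree_of_dvd (dvd_mul_left _ _)) hx
      (fun q hq hqx => h q hq (hqx.mul_left _))
    have hpx : ¬ p ∣ x := by
      rintro ⟨y, rfl⟩
      exact hp.not_isUnit (hF p ⟨y, by ring⟩)
    rcases hp.dvd_or_dvd (h p hp (dvd_mul_right _ _)) with h1 | ⟨y, rfl⟩
    · exact absurd h1 hpx
    · exact ⟨y, by ring⟩

open MvPolynomial in
/-- The key criterion: non-squarefreeness as existence of a nonzero solution of a linear system. -/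
theorem aux_criterion {b e : ℕ} (F : MvPolynomial (Fin b) ℂ) (hF : F.IsHomogeneous (e + 1)) :
    ¬ Squarefree F ↔ ∃ (B : MvPolynomial (Fin b) ℂ) (A : Fin b → MvPolynomial (Fin b) ℂ),
      B.totalDegree ≤ e ∧ (∀ i, (A i).totalDegree ≤ e) ∧ (B ≠ 0 ∨ A ≠ 0) ∧
      ∀ i, B * pderiv i F - A i * F = 0 := by
  by_cases h0 : F = 0
  · subst h0
    refine iff_of_true not_squarefree_zero ⟨1, 0, by simp, by simp, by simp, by simp⟩
  have hd : F.totalDegree = e + 1 := hF.totalDegree h0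
  constructor
  · intro h
    simp only [Squarefree, not_forall] at h
    obtain ⟨q, ⟨r, hr⟩, hq⟩ := h
    have hq0 : q ≠ 0 := by rintro rfl; simp at hr; exact h0 hr
    have hr0 : r ≠ 0 := by rintro rfl; simp at hr; exact h0 hr
    have hqd : 0 < q.totalDegree := by
      rw [Nat.pos_iff_ne_zero]
      intro hz
      rw [totalDegree_eq_zero_iff_eq_C] at hz
      apply hq
      rw [hz]
      apply IsUnit.map
      rw [isUnit_iff_ne_zero]
      intro hc
      rw [hc] at hz
      simp at hz
      exact hq0 hz
    have hB : (q * r).totalDegree ≤ e := by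
      rw [hr, mul_assoc, totalDegree_mul_of_isDomain hq0 (mul_ne_zero hq0 hr0)] at hd
      omega
    have key : ∀ i, (q * r) * pderiv i F - (2 * pderiv i q * r + q * pderiv i r) * F = 0 := by
      intro i
      rw [hr]
      simp only [pderiv_mul]
      ring
    refine ⟨q * r, fun i => 2 * pderiv i q * r + q * pderiv i r, hB, ?_,
      Or.inl (mul_ne_zero hq0 hr0), key⟩
    intro i
    have k := sub_eq_zero.1 (key i)
    set A := 2 * pderiv i q * r + q * pderiv i r with hA
    change A.totalDegree ≤ e
    by_cases hA0 : A = 0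
    · rw [hA0]; simp
    have hp0 : pderiv i F ≠ 0 := by
      intro hz
      rw [hz, mul_zero] at k
      exact mul_ne_zero hA0 h0 k.symm
    have k2 := congrArg totalDegree k
    rw [totalDegree_mul_of_isDomain (mul_ne_zero hq0 hr0) hp0,
      totalDegree_mul_of_isDomain hA0 h0] at k2
    have := aux_pderiv_deg F i hp0
    omega
  · rintro ⟨B, A, hB, -, hne, key⟩ hsq
    have hdvd : F ∣ B := by
      apply aux_sqf_dvd F B hsq h0
      intro p hp hpF
      by_contra hpB
      obtain ⟨g, hg⟩ := hpF
      have hpg : ¬ p ∣ g := by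
        rintro ⟨y, rfl⟩
        exact hp.not_isUnit (hsq p ⟨y, by rw [hg]; ring⟩)
      apply hp.not_isUnit
      have hz : ∀ i, pderiv i p = 0 := by
        intro i
        by_contra hne0
        have h1 : p ∣ B * pderiv i F := by
          rw [sub_eq_zero.1 (key i), hg]
          exact ⟨A i * g, by ring⟩
        have h2 := (hp.dvd_or_dvd h1).resolve_left hpB
        rw [hg, pderiv_mul] at h2
        have h3 : p ∣ pderiv i p * g := (dvd_add_left (dvd_mul_right _ _)).1 h2
        obtain ⟨y, hy⟩ := (hp.dvd_or_dvd h3).resolve_right hpg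
        have hy0 : y ≠ 0 := by rintro rfl; simp at hy; exact hne0 hy
        have := aux_pderiv_deg p i hne0
        rw [hy, totalDegree_mul_of_isDomain hp.ne_zero hy0] at this
        omega
      have h4 := totalDegree_eq_zero_iff_eq_C.1 (aux_pderiv_zero p hz)
      rw [h4]
      apply IsUnit.map
      rw [isUnit_iff_ne_zero]
      intro hc
      rw [hc] at h4
      simp at h4
      exact hp.ne_zero h4
    have hB0 : B = 0 := by
      by_contra hB0
      obtain ⟨y, rfl⟩ := hdvd
      rw [totalDegree_mul_of_isDomain h0 (right_ne_zero_of_mul hB0)] at hB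
      omega
    rcases hne with h | h
    · exact h hB0
    · apply h
      ext1 i
      have := key i
      rw [hB0] at this
      simpa [h0] using this

open MvPolynomial in
theorem aux_functional (a b : ℕ) (Q : MvPolynomial (Fin a ⊕ Fin b) ℂ)
    (ψ : MvPolynomial (Fin b) ℂ →ₗ[ℂ] ℂ) :
    ∃ P : MvPolynomial (Fin a) ℂ, ∀ v : Fin a → ℂ, eval v P =
      ψ (aeval (Sum.elim (fun i => C (v i)) X) Q) := by
  induction Q using MvPolynomial.induction_on' with
  | monomial m c =>
    refine ⟨C (c * ψ (∏ j, X j ^ m (Sum.inr j))) * ∏ i, X i ^ m (Sum.inl i), fun v => ?_⟩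
    rw [aeval_monomial, Finsupp.prod_fintype _ _ (by simp), Fintype.prod_sum_type]
    have : (∏ i, (Sum.elim (fun i => C (v i)) X (Sum.inl i : Fin a ⊕ Fin b) :
        MvPolynomial (Fin b) ℂ) ^ m (Sum.inl i)) = C (∏ i, v i ^ m (Sum.inl i)) := by
      simp
    rw [this, algebraMap_eq, ← mul_assoc, ← C_mul, ← smul_eq_C_mul (∏ _j : Fin b, _) (c * ∏ i, v i ^ m (Sum.inl i)), LinearMap.map_smul]
    simp
    ring
  | add p q hp hq =>
    obtain ⟨P, hP⟩ := hp
    obtain ⟨P', hP'⟩ := hq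
    exact ⟨P + P', fun v => by simp [hP, hP']⟩

open MvPolynomial in
theorem aux_closed {a : ℕ} {E V W : Type*} [AddCommGroup E] [Module ℂ E]
    [AddCommGroup V] [Module ℂ V] [Module.Finite ℂ V] [AddCommGroup W] [Module ℂ W]
    (T : E →ₗ[ℂ] V →ₗ[ℂ] W) (F : (Fin a → ℂ) → E)
    (hF : ∀ ψ : E →ₗ[ℂ] ℂ, ∃ P : MvPolynomial (Fin a) ℂ, ∀ v, eval v P = ψ (F v)) :
    ∃ S : Set (MvPolynomial (Fin a) ℂ), ∀ v,
      (¬ Function.Injective (T (F v))) ↔ ∀ s ∈ S, eval v s = 0 := by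
  let bs := Module.finBasis ℂ V
  have key : ∀ N : W →ₗ[ℂ] V, ∃ P : MvPolynomial (Fin a) ℂ, ∀ v,
      eval v P = LinearMap.det (N ∘ₗ T (F v)) := by
    intro N
    have hM : ∀ i j, ∃ P : MvPolynomial (Fin a) ℂ, ∀ v,
        eval v P = LinearMap.toMatrix bs bs (N ∘ₗ T (F v)) i j := by
      intro i j
      obtain ⟨P, hP⟩ := hF (bs.coord i ∘ₗ N ∘ₗ (T.flip (bs j)))
      refine ⟨P, fun v => ?_⟩
      rw [hP, LinearMap.toMatrix_apply]
      simp
    choose P hP using hM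
    refine ⟨(Matrix.of P).det, fun v => ?_⟩
    rw [← LinearMap.det_toMatrix bs, RingHom.map_det]
    congr 1
    ext i j
    simp [hP]
  choose P hP using key
  refine ⟨Set.range P, fun v => ?_⟩
  constructor
  · rintro h _ ⟨N, rfl⟩
    rw [hP]
    by_contra hdet
    apply h
    have h1 : Function.Injective (N ∘ₗ T (F v)) :=
      ((LinearMap.equivOfDetNeZero _ hdet).injective : _)
    rw [LinearMap.coe_comp] at h1
    exact h1.of_comp
  · intro h hinj
    obtain ⟨N, hN⟩ := LinearMap.exists_leftInverse_of_injective (T (F v))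
      (LinearMap.ker_eq_bot.2 hinj)
    have := h _ ⟨N, rfl⟩
    rw [hP, hN, LinearMap.det_id] at this
    exact one_ne_zero this

open MvPolynomial in
/-- The linear system, depending linearly on `F`. -/
noncomputable def auxT (b e : ℕ) : MvPolynomial (Fin b) ℂ →ₗ[ℂ]
    (restrictTotalDegree (Fin b) ℂ e × (Fin b → restrictTotalDegree (Fin b) ℂ e)) →ₗ[ℂ]
      (Fin b → MvPolynomial (Fin b) ℂ) :=
  LinearMap.mk₂ ℂ (fun F x i => (x.1 : MvPolynomial (Fin b) ℂ) * pderiv i F - (x.2 i : _) * F)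
    (by intros; ext1 i; simp; ring)
    (by intros; ext1 i; simp [mul_sub, smul_sub])
    (by intros; ext1 i; simp; ring)
    (by intros; ext1 i; simp [smul_sub])

open MvPolynomial in
theorem aux_hom (a b : ℕ) (Q : MvPolynomial (Fin a ⊕ Fin b) ℂ) (d : ℕ)
    (h : Q.IsWeightedHomogeneous (Sum.elim (fun _ => 0) (fun _ => 1)) d) (v : Fin a → ℂ) :
    (aeval (Sum.elim (fun i => C (v i)) X) Q : MvPolynomial (Fin b) ℂ).IsHomogeneous d := by
  rw [aeval_def, eval₂_eq]
  apply IsHomogeneous.sum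
  intro m hm
  have hw := h (mem_support_iff.1 hm)
  rw [← hw]
  rw [show (Finsupp.weight (Sum.elim (fun _ => 0) (fun _ => 1)) m : ℕ) =
    0 + ∑ i, (Sum.elim (fun _ => 0) (fun _ => 1) i) * m i by
      rw [Finsupp.weight_apply, Finsupp.sum_fintype _ _ (by simp)]; simp]
  apply IsHomogeneous.mul
  · exact isHomogeneous_C _ _
  · rw [Finset.prod_subset (Finset.subset_univ _) (by intro x _ hx; simp at hx; simp [hx])]
    apply IsHomogeneous.prod
    rintro (i | i) _
    · exact (isHomogeneous_C _ _).pow _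
    · exact (isHomogeneous_X _ _).pow _

/-- let `Q ∈ ℂ[v_1,…,v_a,x_1,…,x_b]` be bihomogeneous. Then the set of
`v ∈ ℂᵃ` such that the specialization `Q_v ∈ ℂ[x_1,…,x_b]` is not squarefree is an
affine algebraic subvariety of `ℂᵃ`: it is the common zero locus of a set `S` of
polynomials in `ℂ[v_1,…,v_a]`. -/
theorem stmt11 (a b : ℕ) (Q : MvPolynomial (Fin a ⊕ Fin b) ℂ)
    (d₁ d₂ : ℕ)
    (h₁ : Q.IsWeightedHomogeneous (Sum.elim (fun _ => 1) (fun _ => 0)) d₁)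
    (h₂ : Q.IsWeightedHomogeneous (Sum.elim (fun _ => 0) (fun _ => 1)) d₂) :
    ∃ S : Set (MvPolynomial (Fin a) ℂ),
      ∀ v : Fin a → ℂ,
        (¬ Squarefree (MvPolynomial.aeval
            (Sum.elim (fun i => MvPolynomial.C (v i)) MvPolynomial.X) Q)) ↔
          ∀ s ∈ S, MvPolynomial.eval v s = 0 := by
  have hhom := aux_hom a b Q d₂ h₂
  cases d₂ with
  | zero =>
    obtain ⟨P, hP⟩ := aux_functional a b Q (MvPolynomial.lcoeff ℂ 0)
    refine ⟨{P}, fun v => ?_⟩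
    simp only [Set.mem_singleton_iff, forall_eq, hP]
    have hv := hhom v
    generalize (MvPolynomial.aeval
            (Sum.elim (fun i => MvPolynomial.C (v i)) MvPolynomial.X) Q :
              MvPolynomial (Fin b) ℂ) = F at hv
    have hF : F = MvPolynomial.C (MvPolynomial.coeff 0 F) :=
      MvPolynomial.totalDegree_eq_zero_iff_eq_C.1 (Nat.le_zero.1 hv.totalDegree_le)
    rw [MvPolynomial.lcoeff_apply]
    constructor
    · intro h
      by_contra hc
      apply h
      rw [hF]
      exact (IsUnit.map _ (isUnit_iff_ne_zero.2 hc)).squarefree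
    · intro h
      rw [hF, h, map_zero]
      exact not_squarefree_zero
  | succ e =>
    obtain ⟨S, hS⟩ := aux_closed (auxT b e)
      (fun v : Fin a → ℂ => (MvPolynomial.aeval
            (Sum.elim (fun i => MvPolynomial.C (v i)) MvPolynomial.X) Q :
              MvPolynomial (Fin b) ℂ)) (aux_functional a b Q)
    refine ⟨S, fun v => ?_⟩
    rw [← hS, aux_criterion _ (hhom v), injective_iff_map_eq_zero]
    push Not
    constructor
    · rintro ⟨B, A, hB, hA, hne, h⟩
      refine ⟨(⟨B, (MvPolynomial.mem_restrictTotalDegree _ _ _).2 hB⟩,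
        fun i => ⟨A i, (MvPolynomial.mem_restrictTotalDegree _ _ _).2 (hA i)⟩), ?_, ?_⟩
      · ext1 i
        exact h i
      · intro hz
        rw [Prod.ext_iff] at hz
        rcases hne with hne | hne
        · exact hne (congrArg Subtype.val hz.1)
        · exact hne (funext fun i => congrArg Subtype.val (congrFun hz.2 i))
    · rintro ⟨⟨B, A⟩, h, hne⟩
      refine ⟨B, fun i => A i, (MvPolynomial.mem_restrictTotalDegree _ _ _).1 B.2,
        fun i => (MvPolynomial.mem_restrictTotalDegree _ _ _).1 (A i).2, ?_,
        fun i => congrFun h i⟩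
      by_contra! hc
      apply hne
      rw [Prod.ext_iff]
      exact ⟨Subtype.ext hc.1, funext fun i => Subtype.ext (congrFun hc.2 i)⟩
end

section
/- Let Q ∈ ℂ[v_1,…,v_a, x_1,…,x_b] be bihomogeneous, i.e., every monomial of Q has the same total degree in the variables v_1,…,v_a and every monomial of Q has the same total degree in the variables x_1,…,x_b. If Q is squarefree as an element of ℂ[v_1,…,v_a, x_1,…,x_b], then there exists v ∈ ℂ^a such that the polynomial Q_v ∈ ℂ[x_1,…,x_b], obtained from Q by substituting the coordinates of v for v_1,…,v_a, is squarefree. -/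
open Polynomial nonZeroDivisors in
lemma aux_bezout {R : Type*} [CommRing R] [IsDomain R] [UniqueFactorizationMonoid R] [CharZero R]
    (f : R[X]) (hf : Squarefree f) :
    ∃ U V : R[X], ∃ D : R, D ≠ 0 ∧ U * f + V * derivative f = Polynomial.C D := by
  let K := FractionRing R
  let : NormalizedGCDMonoid R := Nonempty.some inferInstance
  have : CharZero K := charZero_of_injective_algebraMap (IsFractionRing.injective R K)
  have hf0 : f ≠ 0 := hf.ne_zero
  have inj : Function.Injective (Polynomial.map (algebraMap R K)) :=
    Polynomial.map_injective _ (IsFractionRing.injective R K)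
  have hsq : Squarefree (f.map (algebraMap R K)) := by
    intro q hq
    have hq0 : q ≠ 0 := by
      rintro rfl
      simp only [mul_zero, zero_dvd_iff] at hq
      exact hf0 (inj (by simpa using hq))
    apply isUnit_or_eq_zero_of_isUnit_integerNormalization_primPart (R := R) hq0
    set p := (IsLocalization.integerNormalization R⁰ q).primPart with hp
    have hprim : p.IsPrimitive := isPrimitive_primPart _
    apply hf
    apply (hprim.mul hprim).dvd_of_fraction_map_dvd_fraction_map (K := K)
    have hpq : p.map (algebraMap R K) ∣ q := by
      obtain ⟨c, c0, hc⟩ := IsLocalization.integerNormalization_spec R⁰ q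
      have h1 : p.map (algebraMap R K) ∣ c • q := by
        rw [← hc]
        exact Polynomial.map_dvd _ (primPart_dvd _)
      rw [Algebra.smul_def, Polynomial.algebraMap_apply] at h1
      have hu : IsUnit (Polynomial.C (algebraMap R K c)) :=
        Polynomial.isUnit_C.2 (IsLocalization.map_units K ⟨c, c0⟩)
      exact (hu.dvd_mul_left).1 h1
    rw [Polynomial.map_mul]
    exact (mul_dvd_mul hpq hpq).trans hq
  obtain ⟨u, w, huw⟩ := (PerfectField.separable_iff_squarefree).2 hsq
  obtain ⟨c, c0, hc⟩ := IsLocalization.integerNormalization_spec R⁰ u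
  obtain ⟨d, d0, hd⟩ := IsLocalization.integerNormalization_spec R⁰ w
  refine ⟨Polynomial.C d * IsLocalization.integerNormalization R⁰ u,
    Polynomial.C c * IsLocalization.integerNormalization R⁰ w, c * d,
    mul_ne_zero (nonZeroDivisors.ne_zero c0) (nonZeroDivisors.ne_zero d0), ?_⟩
  apply inj
  rw [Polynomial.derivative_map] at huw
  simp only [Polynomial.map_add, Polynomial.map_mul, hc, hd, Polynomial.map_C, map_mul,
    Algebra.smul_def, Polynomial.algebraMap_apply]
  linear_combination (Polynomial.C (algebraMap R K c) * Polynomial.C (algebraMap R K d)) * huw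

open MvPolynomial in
lemma aux_mv {σ : Type} [DecidableEq σ] [Finite σ] (i : σ) (Q : MvPolynomial σ ℂ)
    (hQ : Squarefree Q) :
    ∃ U V : MvPolynomial σ ℂ, ∃ D : MvPolynomial {j : σ // j ≠ i} ℂ, D ≠ 0 ∧
      U * Q + V * pderiv i Q = rename Subtype.val D := by
  let e : MvPolynomial σ ℂ ≃ₐ[ℂ] Polynomial (MvPolynomial {j : σ // j ≠ i} ℂ) :=
    (renameEquiv ℂ (Equiv.optionSubtypeNe i).symm).trans (optionEquivLeft ℂ _)
  have heC (r : ℂ) : e (C r) = Polynomial.C (C r) := by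
    simp [e, optionEquivLeft_C]
  have heXi : e (X i) = Polynomial.X := by
    simp [e, optionEquivLeft_X_none]
  have heX (j : σ) (h : j ≠ i) : e (X j) = Polynomial.C (X ⟨j, h⟩) := by
    simp [e, h, optionEquivLeft_X_some]
  have hder (P : MvPolynomial σ ℂ) : e (pderiv i P) = Polynomial.derivative (e P) := by
    induction P using MvPolynomial.induction_on with
    | C r => simp [heC]
    | add p q hp hq => simp [hp, hq]
    | mul_X p j hp =>
      rw [pderiv_mul, map_add, map_mul, map_mul, map_mul, hp, Polynomial.derivative_mul]
      by_cases h : j = i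
      · subst h; simp [heXi]
      · simp [heX j h, pderiv_X_of_ne h]
  have hren (D : MvPolynomial {j : σ // j ≠ i} ℂ) :
      e (rename Subtype.val D) = Polynomial.C D := by
    induction D using MvPolynomial.induction_on with
    | C r => simp [heC]
    | add p q hp hq => simp [hp, hq]
    | mul_X p j hp => rw [map_mul, map_mul, hp, rename_X, heX j.1 j.2, Polynomial.C_mul]
  have hsq : Squarefree (e Q) := by
    intro q hq
    have h1 : e.symm q * e.symm q ∣ Q := by
      have := map_dvd e.symm hq
      simpa using this
    have := (hQ _ h1).map e
    simpa using this
  obtain ⟨U, V, D, hD, h⟩ := aux_bezout (e Q) hsq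
  refine ⟨e.symm U, e.symm V, D, hD, e.injective ?_⟩
  rw [hren, map_add, map_mul, map_mul, hder, e.apply_symm_apply, e.apply_symm_apply, h]

open MvPolynomial in
lemma aux_deg {σ : Type} (k : σ) (p : MvPolynomial σ ℂ) : degreeOf k p = 0 ↔ k ∉ p.vars := by
  classical
  rw [degreeOf_def, vars_def, Multiset.mem_toFinset, Multiset.count_eq_zero]

open MvPolynomial in
theorem stmt12 (a b : ℕ) (Q : MvPolynomial (Fin a ⊕ Fin b) ℂ)
    (d₁ d₂ : ℕ)
    (h₁ : Q.IsWeightedHomogeneous (Sum.elim (fun _ => 1) (fun _ => 0)) d₁)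
    (h₂ : Q.IsWeightedHomogeneous (Sum.elim (fun _ => 0) (fun _ => 1)) d₂)
    (hQ : Squarefree Q) :
    ∃ v : Fin a → ℂ,
      Squarefree (MvPolynomial.aeval
        (Sum.elim (fun i => MvPolynomial.C (v i)) MvPolynomial.X) Q) := by
  choose U V D hD hB using fun k : Fin b => aux_mv (Sum.inr k : Fin a ⊕ Fin b) Q hQ
  have hne : Q * ∏ k, rename Subtype.val (D k) ≠ 0 := by
    refine mul_ne_zero hQ.ne_zero (Finset.prod_ne_zero_iff.2 fun k _ h => hD k ?_)
    exact rename_injective _ Subtype.val_injective (by simpa using h)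
  obtain ⟨w, hw⟩ : ∃ w, eval w (Q * ∏ k, rename Subtype.val (D k)) ≠ 0 := by
    by_contra! h
    exact hne (MvPolynomial.funext fun w => by simpa using h w)
  rw [map_mul, map_prod] at hw
  have hwQ := left_ne_zero_of_mul hw
  have hwD := Finset.prod_ne_zero_iff.1 (right_ne_zero_of_mul hw)
  refine ⟨w ∘ Sum.inl, ?_⟩
  set s : MvPolynomial (Fin a ⊕ Fin b) ℂ →ₐ[ℂ] MvPolynomial (Fin b) ℂ := MvPolynomial.aeval
    (Sum.elim (fun i => MvPolynomial.C ((w ∘ Sum.inl) i)) MvPolynomial.X) with hs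
  have hsl (j) : s (X (Sum.inl j)) = C (w (Sum.inl j)) := by simp [hs]
  have hsr (j) : s (X (Sum.inr j)) = X j := by simp [hs]
  have hsC (r) : s (C r) = C r := by simp [hs, algebraMap_eq]
  have hev (P) : eval (w ∘ Sum.inr) (s P) = eval w P := by
    induction P using MvPolynomial.induction_on with
    | C r => simp [hsC]
    | add p q hp hq => simp [hp, hq]
    | mul_X p j hp => rcases j with j | j <;> simp [hp, hsl, hsr]
  have hs0 (P) (h : eval w P ≠ 0) : s P ≠ 0 := by
    intro h0
    apply h
    rw [← hev, h0, map_zero]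
  have hder (k) (P) : s (pderiv (Sum.inr k) P) = pderiv k (s P) := by
    induction P using MvPolynomial.induction_on with
    | C r => simp [hsC]
    | add p q hp hq => simp [hp, hq]
    | mul_X p j hp =>
      rw [pderiv_mul, map_add, map_mul, map_mul, map_mul, hp, pderiv_mul]
      rcases j with j | j
      · simp [hsl]
      · by_cases h : j = k
        · subst h; simp [hsr]
        · simp [hsr, pderiv_X_of_ne h, pderiv_X_of_ne (Sum.inr_injective.ne h)]
  have hdeg (k) (P : MvPolynomial {j : Fin a ⊕ Fin b // j ≠ Sum.inr k} ℂ) :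
      s (rename Subtype.val P) ∈ supported ℂ ({k}ᶜ : Set (Fin b)) := by
    induction P using MvPolynomial.induction_on with
    | C r => rw [rename_C, hsC]; exact Subalgebra.algebraMap_mem _ r
    | add p q hp hq => rw [map_add, map_add]; exact add_mem hp hq
    | mul_X p j hp =>
      rw [map_mul, map_mul]
      refine mul_mem hp ?_
      obtain ⟨j | j, hj⟩ := j
      · rw [rename_X, hsl]; exact Subalgebra.algebraMap_mem _ _
      · rw [rename_X, hsr, X_mem_supported]
        rintro rfl
        exact hj rfl
  rintro q ⟨r, hr⟩
  have hq0 : q ≠ 0 := by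
    rintro rfl
    exact hs0 Q hwQ (by simpa using hr)
  have hvars : q.vars = ∅ := by
    rw [Finset.eq_empty_iff_forall_notMem]
    intro k hk
    have hdvd : q ∣ s (rename Subtype.val (D k)) := by
      rw [← hB k, map_add, map_mul, map_mul, hder, hr, pderiv_mul, pderiv_mul]
      exact ⟨s (U k) * q * r + s (V k) * (2 * pderiv k q * r + q * pderiv k r), by ring⟩
    obtain ⟨t, ht⟩ := hdvd
    have hne0 := hs0 _ (hwD k (Finset.mem_univ k))
    have ht0 : t ≠ 0 := by
      rintro rfl
      exact hne0 (by simpa using ht)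
    have h3 := mem_supported.1 (hdeg k (D k))
    have h4 : degreeOf k (s (rename Subtype.val (D k))) = 0 :=
      (aux_deg k _).2 fun h => h3 (Finset.mem_coe.2 h) rfl
    rw [ht, degreeOf_mul_eq hq0 ht0] at h4
    exact (aux_deg k q).1 (by omega) hk
  rw [vars_eq_empty_iff_eq_C] at hvars
  rw [hvars]
  refine IsUnit.map C (isUnit_iff_ne_zero.2 fun h => hq0 ?_)
  rw [hvars, h, C_0]
end

section
/- With the notation of the context: (i) if there exist linear subspaces V_1,…,V_l of ℂⁿ with dim V_i = k_i, A_i V_i ⊆ V_i for every i, and V_1 + … + V_l ≠ ℂⁿ, then P = 0; (ii) conversely, if the characteristic polynomial of A has no repeated roots and P = 0, then there exist such subspaces V_1,…,V_l (with dim V_i = k_i, A_i V_i ⊆ V_i, and V_1 + … + V_l ≠ ℂⁿ). -/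
/-- The matrix, in the standard basis `e_S = e_{s_1} ∧ … ∧ e_{s_k}` of `Λᵏℂⁿ`
(indexed by `k`-element subsets `S` of `Fin n`), of the derivation
`v_1 ∧ … ∧ v_k ↦ ∑ j, v_1 ∧ … ∧ B v_j ∧ … ∧ v_k`:
`Λ'_k(B)(S,T) = ∑_j det C_j`, where `(C_j)_{p,q} = B_{s_p,t_q}` if `p = j` and
`(C_j)_{p,q} = [s_p = t_q]` otherwise, with `s_p`, `t_q` listing `S`, `T` increasingly. -/
noncomputable def lamDer (n k : ℕ) (B : Matrix (Fin n) (Fin n) ℂ) :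
    Matrix {s : Finset (Fin n) // s.card = k} {s : Finset (Fin n) // s.card = k} ℂ :=
  Matrix.of fun S T => ∑ j : Fin k,
    Matrix.det (Matrix.of fun p q : Fin k =>
      if p = j then B ((S.1.orderIsoOfFin S.2 p : Fin n)) ((T.1.orderIsoOfFin T.2 q : Fin n))
      else if ((S.1.orderIsoOfFin S.2 p : Fin n) = (T.1.orderIsoOfFin T.2 q : Fin n))
        then (1 : ℂ) else 0)

/-- The matrix `A` on `Λ^{k_1}ℂⁿ ⊗ ⋯ ⊗ Λ^{k_l}ℂⁿ`, with rows and columns indexed by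
`l`-tuples `S = (S_1, …, S_l)` of subsets with `|S_i| = k_i`:
`A(S,T) = ∑ i, Λ'_{k_i}(A_i)(S_i,T_i) ⋅ ∏_{j ≠ i} [S_j = T_j]`. -/
noncomputable def genA (n l : ℕ) (k : Fin l → ℕ) (A : Fin l → Matrix (Fin n) (Fin n) ℂ) :
    Matrix (∀ i, {s : Finset (Fin n) // s.card = k i})
      (∀ i, {s : Finset (Fin n) // s.card = k i}) ℂ :=
  Matrix.of fun S T => ∑ i : Fin l,
    lamDer n (k i) (A i) (S i) (T i) *
      ∏ j ∈ Finset.univ.erase i, (if S j = T j then (1 : ℂ) else 0)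

/-- The row vector `w̄`: `w̄ S = 0` if the `S_i` are not pairwise disjoint, and otherwise
`w̄ S` is the sign of the permutation of `Fin n` obtained by concatenating the increasing
lists of `S_1, S_2, …, S_l`. -/
noncomputable def genW (n l : ℕ) (k : Fin l → ℕ) :
    (∀ i, {s : Finset (Fin n) // s.card = k i}) → ℂ := fun S =>
  ∑ π : Equiv.Perm (Fin n),
    if List.ofFn ⇑π = (List.ofFn fun i => (S i).1.sort (· ≤ ·)).flatten
    then ((Equiv.Perm.sign π : ℤ) : ℂ) else 0

/-- The square matrix `M` whose rows are `w̄, w̄A, w̄A², …, w̄A^{|D|−1}`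
(rows indexed by the tuples `S` via a bijection with `Fin |D|`). -/
noncomputable def genM (n l : ℕ) (k : Fin l → ℕ) (A : Fin l → Matrix (Fin n) (Fin n) ℂ) :
    Matrix (∀ i, {s : Finset (Fin n) // s.card = k i})
      (∀ i, {s : Finset (Fin n) // s.card = k i}) ℂ :=
  Matrix.of fun S T =>
    Matrix.vecMul (genW n l k)
      (genA n l k A ^ ((Fintype.equivFin (∀ i, {s : Finset (Fin n) // s.card = k i})) S : ℕ)) T

/-- `P = det M`. -/
noncomputable def genP (n l : ℕ) (k : Fin l → ℕ) (A : Fin l → Matrix (Fin n) (Fin n) ℂ) : ℂ :=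
  (genM n l k A).det


/-- Increasing enumeration of a `k`-subset. -/
noncomputable def en {n k : ℕ} (S : {s : Finset (Fin n) // s.card = k}) (p : Fin k) : Fin n :=
  (S.1.orderIsoOfFin S.2 p : Fin n)

lemma en_inj {n k : ℕ} (S : {s : Finset (Fin n) // s.card = k}) :
    Function.Injective (en S) := by
  intro a b h
  exact (S.1.orderIsoOfFin S.2).injective (Subtype.ext h)

lemma en_mem {n k : ℕ} (S : {s : Finset (Fin n) // s.card = k}) (p : Fin k) : en S p ∈ S.1 :=
  (S.1.orderIsoOfFin S.2 p).2

lemma en_surj {n k : ℕ} (S : {s : Finset (Fin n) // s.card = k}) {x : Fin n} (hx : x ∈ S.1) :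
    ∃ p, en S p = x :=
  ⟨(S.1.orderIsoOfFin S.2).symm ⟨x, hx⟩, by simp [en]⟩

/-- Coordinate form. -/
noncomputable def eps {n k : ℕ} (S : {s : Finset (Fin n) // s.card = k}) :
    (Fin n → ℂ) [⋀^Fin k]→ₗ[ℂ] ℂ :=
  (Matrix.detRowAlternating (n := Fin k) (R := ℂ)).compLinearMap (LinearMap.funLeft ℂ ℂ (en S))

lemma eps_apply {n k : ℕ} (S : {s : Finset (Fin n) // s.card = k}) (w : Fin k → Fin n → ℂ) :
    eps S w = Matrix.det (Matrix.of fun q p => w q (en S p)) := rfl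

/-- Standard basis vectors. -/
noncomputable def eb {n k : ℕ} (S : {s : Finset (Fin n) // s.card = k}) (p : Fin k) : Fin n → ℂ :=
  Pi.single (en S p) 1

lemma eps_ne {n k : ℕ} (S : {s : Finset (Fin n) // s.card = k}) (σ : Fin k → Fin n)
    (h : ∃ q, σ q ∉ S.1) : eps S (fun q => Pi.single (σ q) 1) = 0 := by
  obtain ⟨q, hq⟩ := h
  rw [eps_apply]
  apply Matrix.det_eq_zero_of_row_eq_zero q
  intro p
  simp only [Matrix.of_apply]
  rw [Pi.single_apply, if_neg]
  intro h
  exact hq (h ▸ en_mem S p)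

lemma eps_self {n k : ℕ} (S : {s : Finset (Fin n) // s.card = k}) : eps S (eb S) = 1 := by
  rw [eps_apply]
  convert Matrix.det_one (n := Fin k) (R := ℂ) using 2
  ext q p
  simp [eb, Pi.single_apply, Matrix.one_apply, (en_inj S).eq_iff, eq_comm]

lemma exists_notMem {n k : ℕ} (S : {s : Finset (Fin n) // s.card = k}) (σ : Fin k → Fin n)
    (hσ : Function.Injective σ) (h : S.1 ≠ Finset.univ.image σ) : ∃ q, σ q ∉ S.1 := by
  by_contra! hc
  apply h
  symm
  apply Finset.eq_of_subset_of_card_le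
  · intro x hx
    obtain ⟨q, -, rfl⟩ := Finset.mem_image.1 hx
    exact hc q
  · rw [S.2, Finset.card_image_of_injective _ hσ]; simp

lemma eps_eb {n k : ℕ} (S T : {s : Finset (Fin n) // s.card = k}) :
    eps S (eb T) = if S = T then 1 else 0 := by
  split_ifs with h
  · subst h; exact eps_self S
  · apply eps_ne
    apply exists_notMem _ _ (en_inj T)
    intro h'
    apply h
    apply Subtype.ext
    apply Finset.eq_of_subset_of_card_le
    · rw [h']
      intro x hx
      obtain ⟨q, -, rfl⟩ := Finset.mem_image.1 hx
      exact en_mem T q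
    · rw [S.2, T.2]

lemma alt_sum_apply {V ι κ : Type*} [AddCommGroup V] [Module ℂ V] (s : Finset κ)
    (f : κ → V [⋀^ι]→ₗ[ℂ] ℂ) (w : ι → V) : (∑ j ∈ s, f j) w = ∑ j ∈ s, f j w := by
  classical
  induction s using Finset.induction_on with
  | empty => simp
  | insert a s ha ih => simp [Finset.sum_insert ha, ih]

/-- Expansion of an alternating form. -/
lemma expand {n k : ℕ} (ψ : (Fin n → ℂ) [⋀^Fin k]→ₗ[ℂ] ℂ) (w : Fin k → Fin n → ℂ) :
    ψ w = ∑ T : {s : Finset (Fin n) // s.card = k}, ψ (eb T) * eps T w := by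
  have key : ψ = ∑ T : {s : Finset (Fin n) // s.card = k}, ψ (eb T) • eps T := by
    apply Module.Basis.ext_alternating (Pi.basisFun ℂ (Fin n))
    intro σ hσ
    simp only [Pi.basisFun_apply]
    let T : {s : Finset (Fin n) // s.card = k} :=
      ⟨Finset.univ.image σ, by rw [Finset.card_image_of_injective _ hσ]; simp⟩
    have h1 : ∀ q, ∃ p, en T p = σ q := fun q => en_surj T (by simp [T])
    choose π hπ using h1
    have hinj : Function.Injective π := by
      intro a b hab
      apply hσ
      rw [← hπ, ← hπ, hab]
    let π' : Equiv.Perm (Fin k) := Equiv.ofBijective π (Finite.injective_iff_bijective.1 hinj)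
    have hs : (fun q => Pi.single (σ q) (1 : ℂ) : Fin k → Fin n → ℂ) = eb T ∘ π' := by
      funext q
      simp only [Function.comp, eb]
      rw [← hπ q]; rfl
    rw [alt_sum_apply, Finset.sum_eq_single T]
    · rw [hs, AlternatingMap.smul_apply, AlternatingMap.map_perm, AlternatingMap.map_perm, eps_self]
      simp [mul_comm]
    · intro S _ hST
      rw [AlternatingMap.smul_apply, eps_ne, smul_zero]
      apply exists_notMem _ _ hσ
      intro h
      exact hST (Subtype.ext h)
    · simp
  conv_lhs => rw [key]
  simp [alt_sum_apply]

lemma row_col {k : ℕ} (N N' : Matrix (Fin k) (Fin k) ℂ) :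
    ∑ j, (N.updateRow j (N' j)).det = ∑ j, (N.updateCol j (fun i => N' i j)).det := by
  have h1 : ∀ j, (N.updateCol j (fun i => N' i j)).det = ∑ i, N.adjugate j i * N' i j := by
    intro j
    rw [← Matrix.cramer_apply, Matrix.cramer_eq_adjugate_mulVec]; rfl
  have h2 : ∀ j, (N.updateRow j (N' j)).det = ∑ i, N.adjugate i j * N' j i := by
    intro j
    rw [← Matrix.cramer_transpose_apply, Matrix.cramer_eq_adjugate_mulVec,
      ← Matrix.adjugate_transpose]; rfl
  simp only [h1, h2]
  exact Finset.sum_comm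

lemma lamDer_eps {n k : ℕ} (B : Matrix (Fin n) (Fin n) ℂ)
    (S : {s : Finset (Fin n) // s.card = k}) (w : Fin k → Fin n → ℂ) :
    ∑ T, lamDer n k B S T * eps T w = ∑ j, eps S (Function.update w j (B.mulVec (w j))) := by
  let R : Fin k → Matrix (Fin k) (Fin n) ℂ := fun j => Matrix.of fun p x =>
    if p = j then B (en S p) x else if en S p = x then 1 else 0
  let ψ : (Fin n → ℂ) [⋀^Fin k]→ₗ[ℂ] ℂ := ∑ j,
    (Matrix.detRowAlternating (n := Fin k) (R := ℂ)).compLinearMap (Matrix.toLin' (R j))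
  have hψ : ∀ w, ψ w = ∑ j, Matrix.det (Matrix.of fun q p => (R j).mulVec (w q) p) := by
    intro w
    simp only [ψ, alt_sum_apply]
    rfl
  have h1 : ∀ T, lamDer n k B S T = ψ (eb T) := by
    intro T
    rw [hψ]
    simp only [lamDer, Matrix.of_apply]
    refine Finset.sum_congr rfl fun j _ => ?_
    rw [← Matrix.det_transpose]
    congr 1
    ext q p
    simp [Matrix.transpose_apply, eb, R, en]
    rfl
  simp only [h1]
  rw [← expand ψ w, hψ]
  have h2 : ∀ j, Matrix.det (Matrix.of fun q p => (R j).mulVec (w q) p) =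
      ((Matrix.of fun q p => w q (en S p)).updateCol j
        (fun i => (Matrix.of fun q p => B.mulVec (w q) (en S p)) i j)).det := by
    intro j
    congr 1
    ext q p
    rw [Matrix.updateCol_apply]
    simp only [Matrix.of_apply, R, Matrix.mulVec, dotProduct]
    split_ifs with h
    · subst h; simp
    · simp [h]
  simp only [h2]
  rw [← row_col]
  refine Finset.sum_congr rfl fun j _ => ?_
  rw [eps_apply]
  congr 1
  ext q p
  rw [Matrix.updateRow_apply]
  by_cases h : q = j
  · subst h; simp
  · simp [h]

section Eig
variable {V : Type*} [AddCommGroup V] [Module ℂ V]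

lemma sum_cons {k : ℕ} (B : Module.End ℂ V) (φ : V [⋀^Fin (k+1)]→ₗ[ℂ] ℂ) (u : V)
    (w : Fin k → V) :
    ∑ j, φ (Function.update (Matrix.vecCons u w) j (B (Matrix.vecCons u w j))) =
      φ (Matrix.vecCons (B u) w) +
        ∑ j, φ.curryLeft u (Function.update w j (B (w j))) := by
  rw [Fin.sum_univ_succ]
  congr 1
  · congr 1
    simp only [Matrix.vecCons]
    rw [Fin.update_cons_zero]
    simp
  · refine Finset.sum_congr rfl fun j _ => ?_
    rw [AlternatingMap.curryLeft_apply_apply]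
    simp only [Matrix.vecCons]
    rw [Fin.cons_update]
    simp

/-- vanishing criterion -/
lemma vanish {ι : Type*} [Fintype ι] [DecidableEq ι] (H : Submodule ℂ V) (g : V →ₗ[ℂ] ℂ) (u : V) (huH : u ∈ H)
    (hu : g u = 1) (χ : V [⋀^ι]→ₗ[ℂ] ℂ)
    (h0 : ∀ w : ι → V, (∀ i, w i ∈ H) → (∀ i, g (w i) = 0) → χ w = 0)
    (h1 : ∀ w : ι → V, (∀ i, w i ∈ H) → ∀ i, χ (Function.update w i u) = 0)
    (w : ι → V) (hw : ∀ i, w i ∈ H) : χ w = 0 := by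
  have key : ∀ (s : Finset ι) (w : ι → V), (∀ i, w i ∈ H) → (∀ i, i ∉ s → g (w i) = 0) →
      χ w = 0 := by
    intro s
    induction s using Finset.induction_on with
    | empty => intro w hw hg; exact h0 w hw (fun i => hg i (by simp))
    | insert a s ha ih =>
      intro w hw hg
      have e : w = Function.update w a (g (w a) • u + (w a - g (w a) • u)) := by simp
      rw [e, AlternatingMap.map_update_add, AlternatingMap.map_update_smul, h1 w hw a, smul_zero,
        zero_add]
      apply ih
      · intro i
        by_cases h : i = a
        · subst h; simp only [Function.update_self]
          exact H.sub_mem (hw _) (H.smul_mem _ huH)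
        · rw [Function.update_of_ne h]; exact hw i
      · intro i hi
        by_cases h : i = a
        · subst h; simp [hu]
        · rw [Function.update_of_ne h]; exact hg i (by simp [h, hi])
  exact key Finset.univ w hw (by simp)

lemma eigen_sub [FiniteDimensional ℂ V] (B : Module.End ℂ V) : ∀ (d : ℕ) (H : Submodule ℂ V)
    (_ : ∀ x ∈ H, B x ∈ H) (_ : Module.finrank ℂ H = d) (k : ℕ) (φ : V [⋀^Fin k]→ₗ[ℂ] ℂ) (μ : ℂ)
    (_ : ∃ w, (∀ i, w i ∈ H) ∧ φ w ≠ 0)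
    (_ : ∀ w, (∀ i, w i ∈ H) → ∑ j, φ (Function.update w j (B (w j))) = μ * φ w),
    ∃ w : Fin k → V, (∀ i, w i ∈ H) ∧ LinearIndependent ℂ w ∧
      (∀ i, B (w i) ∈ Submodule.span ℂ (Set.range w)) ∧
      ∀ ψ : V [⋀^Fin k]→ₗ[ℂ] ℂ, ∑ j, ψ (Function.update w j (B (w j))) = μ * ψ w := by
  intro d
  induction d with
  | zero =>
    intro H hH hd k φ μ ⟨w, hw, hne⟩ heig
    cases k with
    | zero =>
      refine ⟨w, hw, linearIndependent_empty_type, fun i => i.elim0, ?_⟩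
      have := heig w hw
      simp only [Finset.univ_eq_empty, Finset.sum_empty] at this
      have hμ : μ = 0 := by
        rcases mul_eq_zero.1 this.symm with h | h
        · exact h
        · exact absurd h hne
      intro ψ
      simp [hμ]
    | succ k =>
      exfalso
      rw [Submodule.finrank_eq_zero] at hd
      subst hd
      exact hne (φ.map_coord_zero 0 (by simpa using hw 0))
  | succ d ih =>
    intro H hH hd k φ μ ⟨w, hw, hne⟩ heig
    cases k with
    | zero =>
      refine ⟨w, hw, linearIndependent_empty_type, fun i => i.elim0, ?_⟩
      have := heig w hw
      simp only [Finset.univ_eq_empty, Finset.sum_empty] at this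
      have hμ : μ = 0 := by
        rcases mul_eq_zero.1 this.symm with h | h
        · exact h
        · exact absurd h hne
      intro ψ
      simp [hμ]
    | succ k =>
      have : Nontrivial H := Module.nontrivial_of_finrank_pos (R := ℂ) (by omega)
      obtain ⟨c, hc⟩ := Module.End.exists_eigenvalue (Module.Dual.transpose (R := ℂ) (B.restrict hH))
      obtain ⟨f, hf⟩ := hc.exists_hasEigenvector
      have hf0 : f ≠ 0 := hf.2
      have hfB : ∀ x : H, f (B.restrict hH x) = c * f x := fun x => by
        have := congrArg (fun g => g x) hf.apply_eq_smul
        simpa [Module.Dual.transpose_apply] using this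
      obtain ⟨g, hg⟩ := LinearMap.exists_extend f
      have hgf : ∀ x : H, g x = f x := fun x => by rw [← hg]; rfl
      have hgB : ∀ x ∈ H, g (B x) = c * g x := fun x hx => by
        have := hfB ⟨x, hx⟩
        rw [← hgf, ← hgf] at this
        simpa using this
      obtain ⟨u, huH, hu⟩ : ∃ u ∈ H, g u = 1 := by
        obtain ⟨x, hx⟩ : ∃ x, f x ≠ 0 := by
          by_contra! h
          exact hf0 (LinearMap.ext h)
        refine ⟨(f x)⁻¹ • (x : V), H.smul_mem _ x.2, ?_⟩
        rw [map_smul, hgf, smul_eq_mul, inv_mul_cancel₀ hx]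
      have hH' : ∀ x ∈ H ⊓ LinearMap.ker g, B x ∈ H ⊓ LinearMap.ker g := by
        intro x hx
        refine ⟨hH x hx.1, ?_⟩
        have h2 : g x = 0 := hx.2
        change g (B x) = 0
        rw [hgB x hx.1, h2, mul_zero]
      have hd' : Module.finrank ℂ ↥(H ⊓ LinearMap.ker g) = d := by
        have e : H ⊓ LinearMap.ker g = (LinearMap.ker f).map H.subtype := by
          ext x
          simp only [Submodule.mem_inf, LinearMap.mem_ker, Submodule.mem_map, Submodule.subtype_apply]
          constructor
          · rintro ⟨h1, h2⟩
            exact ⟨⟨x, h1⟩, by rw [← hgf]; exact h2, rfl⟩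
          · rintro ⟨y, h1, rfl⟩
            exact ⟨y.2, by rw [hgf]; exact h1⟩
        rw [e, Submodule.finrank_map_subtype_eq]
        have := Module.Dual.finrank_ker_add_one_of_ne_zero hf0
        omega
      by_cases hv : ∃ w, (∀ i, w i ∈ H ⊓ LinearMap.ker g) ∧ φ w ≠ 0
      · obtain ⟨w, h1, h2, h3, h4⟩ := ih _ hH' hd' (k+1) φ μ hv
          (fun w hw => heig w (fun i => (hw i).1))
        exact ⟨w, fun i => (h1 i).1, h2, h3, h4⟩
      · have hv' : ∀ w, (∀ i, w i ∈ H ⊓ LinearMap.ker g) → φ w = 0 := by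
          intro w hw
          by_contra hc
          exact hv ⟨w, hw, hc⟩
        have hψ : ∃ w, (∀ i, w i ∈ H ⊓ LinearMap.ker g) ∧ φ.curryLeft u w ≠ 0 := by
          by_contra! hc
          have hψ0 : ∀ w, (∀ i, w i ∈ H) → φ.curryLeft u w = 0 := by
            apply vanish H g u huH hu
            · intro w h1 h2
              exact hc w (fun i => ⟨h1 i, h2 i⟩)
            · intro w hw i
              rw [AlternatingMap.curryLeft_apply_apply]
              apply φ.map_eq_zero_of_eq _ (i := 0) (j := i.succ) _ (Fin.succ_ne_zero i).symm
              simp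
          apply hne
          apply vanish H g u huH hu φ _ _ w hw
          · intro w h1 h2
            exact hv' w (fun i => ⟨h1 i, h2 i⟩)
          · have h0 : ∀ v : Fin (k+1) → V, (∀ i, v i ∈ H) → v 0 = u → φ v = 0 := by
              intro v hv h0
              have e : v = Matrix.vecCons u (fun i => v i.succ) := by
                funext i
                refine Fin.cases ?_ (fun i => ?_) i <;> simp [h0]
              rw [e, ← AlternatingMap.curryLeft_apply_apply]
              exact hψ0 _ (fun i => hv _)
            intro w hw i
            have hm : ∀ j, Function.update w i u j ∈ H := by
              intro j
              by_cases h : j = i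
              · subst h; simpa
              · rw [Function.update_of_ne h]; exact hw j
            by_cases hi : i = 0
            · subst hi
              exact h0 _ hm (by simp)
            · have := φ.map_swap (Function.update w i u) hi
              rw [h0 (Function.update w i u ∘ Equiv.swap i 0) (fun j => hm _) (by simp)] at this
              simpa using this.symm
        obtain ⟨w', h1, h2, h3, h4⟩ := ih _ hH' hd' k (φ.curryLeft u) (μ - c) hψ (by
          intro w hw
          have e := sum_cons B φ u w
          have hm : ∀ j, Matrix.vecCons u w j ∈ H := by
            intro j
            refine Fin.cases ?_ (fun i => ?_) j
            · simpa
            · simpa using (hw i).1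
          rw [heig _ hm] at e
          have e2 : φ (Matrix.vecCons (B u) w) = c * φ (Matrix.vecCons u w) := by
            have : B u = c • u + (B u - c • u) := by simp
            rw [this, AlternatingMap.map_vecCons_add, AlternatingMap.map_vecCons_smul,
              hv' (Matrix.vecCons (B u - c • u) w), add_zero, smul_eq_mul]
            intro j
            refine Fin.cases ?_ (fun i => ?_) j
            · refine ⟨H.sub_mem (hH u huH) (H.smul_mem _ huH), ?_⟩
              simp [hgB u huH, hu]
            · simpa using (hw i)
          rw [e2] at e
          rw [AlternatingMap.curryLeft_apply_apply, sub_mul, e]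
          ring)
        have hW' : Submodule.span ℂ (Set.range w') ≤ H ⊓ LinearMap.ker g := by
          rw [Submodule.span_le]
          rintro _ ⟨i, rfl⟩
          exact h1 i
        have hWk : Module.finrank ℂ (Submodule.span ℂ (Set.range w')) = k := by
          rw [finrank_span_eq_card h2]; simp
        obtain ⟨x, hxH, hxW, hBx⟩ : ∃ x ∈ H, x ∉ Submodule.span ℂ (Set.range w') ∧
            B x - c • x ∈ Submodule.span ℂ (Set.range w') := by
          by_contra! hcon
          set W := Submodule.span ℂ (Set.range w') with hW
          let T : H →ₗ[ℂ] V ⧸ W := W.mkQ ∘ₗ (B - c • LinearMap.id) ∘ₗ H.subtype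
          let q : ↥(H ⊓ LinearMap.ker g) →ₗ[ℂ] V ⧸ W := W.mkQ ∘ₗ (H ⊓ LinearMap.ker g).subtype
          have r1 := LinearMap.finrank_range_add_finrank_ker T
          have r2 := LinearMap.finrank_range_add_finrank_ker q
          have r3 : LinearMap.range T ≤ LinearMap.range q := by
            rintro _ ⟨y, rfl⟩
            refine ⟨⟨B y - c • y, H.sub_mem (hH y y.2) (H.smul_mem _ y.2), ?_⟩, ?_⟩
            · simp [hgB y y.2]
            · simp [q, T]
          have r4 := Submodule.finrank_mono r3
          have r5 : Module.finrank ℂ (LinearMap.ker T) ≤ k := by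
            rw [← hWk, ← Submodule.finrank_map_subtype_eq]
            apply Submodule.finrank_mono
            rintro _ ⟨y, hy, rfl⟩
            by_contra hn
            refine hcon y y.2 hn ?_
            have : T y = 0 := hy
            simpa [T, Submodule.Quotient.mk_eq_zero, ← Submodule.Quotient.mk_sub,
              ← Submodule.Quotient.mk_smul] using this
          have r6 : k ≤ Module.finrank ℂ (LinearMap.ker q) := by
            rw [← hWk, ← Submodule.finrank_map_subtype_eq _ (LinearMap.ker q)]
            apply Submodule.finrank_mono
            intro y hy
            exact ⟨⟨y, hW' hy⟩, by simpa [q] using hy, rfl⟩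
          omega
        have hspan : Submodule.span ℂ (Set.range w') ≤
            Submodule.span ℂ (Set.range (Matrix.vecCons x w')) := by
          apply Submodule.span_mono
          rintro _ ⟨i, rfl⟩
          exact ⟨i.succ, by simp⟩
        refine ⟨Matrix.vecCons x w', ?_, ?_, ?_, ?_⟩
        · intro j
          refine Fin.cases ?_ (fun i => ?_) j
          · simpa
          · simpa using (h1 i).1
        · exact linearIndependent_finCons.2 ⟨h2, hxW⟩
        · intro j
          refine Fin.cases ?_ (fun i => ?_) j
          · have : B x = (B x - c • x) + c • x := by simp
            simp only [Matrix.cons_val_zero]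
            rw [this]
            refine Submodule.add_mem _ (hspan hBx) (Submodule.smul_mem _ _ ?_)
            exact Submodule.subset_span ⟨0, by simp⟩
          · simpa using hspan (h3 i)
        · intro ψ
          rw [sum_cons, h4 (ψ.curryLeft x)]
          have : B x = (B x - c • x) + c • x := by simp
          rw [this, AlternatingMap.map_vecCons_add, AlternatingMap.map_vecCons_smul,
            AlternatingMap.curryLeft_apply_apply]
          have hz : ψ (Matrix.vecCons (B x - c • x) w') = 0 := by
            apply AlternatingMap.map_linearDependent
            intro hl
            exact (linearIndependent_finCons.1 hl).2 hBx
          rw [hz, smul_eq_mul]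
          ring

end Eig

lemma exists_cat (n l : ℕ) (k : Fin l → ℕ) (hsum : ∑ i, k i = n) :
    ∃ e : Fin n ≃ (Σ i, Fin (k i)), ∀ f : (∀ i, Fin (k i) → Fin n),
      (List.ofFn fun i => List.ofFn (f i)).flatten = List.ofFn fun a => f (e a).1 (e a).2 := by
  let L : List (Σ i, Fin (k i)) :=
    (List.ofFn fun i => List.ofFn fun j => (⟨i, j⟩ : Σ i, Fin (k i))).flatten
  have hmem : ∀ x, x ∈ L := by
    rintro ⟨i, j⟩
    simp [L, List.mem_flatten, List.mem_ofFn]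
  have hnd : L.Nodup := by
    rw [List.nodup_flatten]
    constructor
    · intro m hm
      obtain ⟨i, rfl⟩ := List.mem_ofFn.1 hm
      exact List.nodup_ofFn.2 (fun a b h => by simpa using h)
    · rw [List.pairwise_ofFn]
      intro i j hij x hx hy
      obtain ⟨a, rfl⟩ := List.mem_ofFn.1 hx
      obtain ⟨b, hb⟩ := List.mem_ofFn.1 hy
      exact hij.ne (congrArg Sigma.fst hb).symm
  have hlen : L.length = n := by
    simp only [L, List.length_flatten, List.map_ofFn, List.sum_ofFn, ← hsum]
    simp
  let e0 := hnd.getEquivOfForallMemList L hmem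
  refine ⟨(finCongr hlen.symm).trans e0, ?_⟩
  intro f
  have h1 : (List.ofFn fun i => List.ofFn (f i)).flatten = L.map (fun x => f x.1 x.2) := by
    simp only [L, List.map_flatten, List.map_ofFn]
    congr 1
    congr 1
    funext i
    simp [List.map_ofFn, Function.comp_def]
  rw [h1]
  apply List.ext_getElem
  · simp [hlen]
  · intro m h1 h2
    simp [e0, List.Nodup.getEquivOfForallMemList]
    rfl

lemma sort_eq {n k : ℕ} (S : {s : Finset (Fin n) // s.card = k}) :
    S.1.sort (· ≤ ·) = List.ofFn (en S) := by
  apply List.ext_getElem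
  · simp [S.2]
  · intro m h1 h2
    simp [en, Finset.orderEmbOfFin_apply]

lemma multi_expand (n : ℕ) : ∀ (l : ℕ) (k : Fin l → ℕ)
    (F : (∀ i, Fin (k i) → Fin n → ℂ) → ℂ)
    (_ : ∀ w i, ∃ ψ : (Fin n → ℂ) [⋀^Fin (k i)]→ₗ[ℂ] ℂ, ∀ v, F (Function.update w i v) = ψ v)
    (w : ∀ i, Fin (k i) → Fin n → ℂ),
    F w = ∑ S : (∀ i, {s : Finset (Fin n) // s.card = k i}),
      F (fun i => eb (S i)) * ∏ i, eps (S i) (w i) := by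
  intro l
  induction l with
  | zero =>
    intro k F _ w
    simp only [Finset.univ_eq_empty, Finset.prod_empty, mul_one, Fintype.sum_unique]
    congr 1
    funext i
    exact i.elim0
  | succ l ih =>
    intro k F hF w
    obtain ⟨ψ, hψ⟩ := hF w 0
    have h0 : ∀ v, F (Fin.cons v (Fin.tail w)) = ψ v := by
      intro v
      rw [← hψ]
      congr 1
      conv_rhs => rw [← Fin.cons_self_tail w]
      rw [Fin.update_cons_zero]
    have h1 : F w = ∑ T : {s : Finset (Fin n) // s.card = k 0},
        F (Fin.cons (eb T) (Fin.tail w)) * eps T (w 0) := by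
      conv_lhs => rw [← Fin.cons_self_tail w, h0, expand]
      simp only [h0]
    rw [h1]
    rw [← (Fin.consEquiv (fun i => {s : Finset (Fin n) // s.card = k i})).sum_comp,
      Fintype.sum_prod_type]
    refine Finset.sum_congr rfl fun T _ => ?_
    have h2 := ih (fun i => k i.succ) (fun w' => F (Fin.cons (eb T) w')) (by
      intro w' i
      obtain ⟨χ, hχ⟩ := hF (Fin.cons (eb T) w') i.succ
      refine ⟨χ, fun v => ?_⟩
      rw [← hχ, Fin.cons_update]) (Fin.tail w)
    rw [h2, Finset.sum_mul]
    refine Finset.sum_congr rfl fun S _ => ?_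
    rw [Fin.prod_univ_succ]
    have h3 : (fun i => eb ((Fin.consEquiv (fun i => {s : Finset (Fin n) // s.card = k i})) (T, S) i))
        = (Fin.cons (eb T) (fun i => eb (S i)) : ∀ i, Fin (k i) → Fin n → ℂ) := by
      funext i
      refine Fin.cases ?_ (fun i => ?_) i <;> simp [Fin.consEquiv]
    rw [h3]
    simp [Fin.consEquiv, Fin.tail]
    ring

/-- the concatenated determinant -/
noncomputable def catDet {n l : ℕ} {k : Fin l → ℕ} (e : Fin n ≃ (Σ i, Fin (k i)))
    (w : ∀ i, Fin (k i) → Fin n → ℂ) : ℂ :=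
  Matrix.det (Matrix.of fun a b : Fin n => w (e a).1 (e a).2 b)

lemma catDet_alt {n l : ℕ} {k : Fin l → ℕ} (e : Fin n ≃ (Σ i, Fin (k i)))
    (w : ∀ i, Fin (k i) → Fin n → ℂ) (i : Fin l) :
    ∃ ψ : (Fin n → ℂ) [⋀^Fin (k i)]→ₗ[ℂ] ℂ, ∀ v, catDet e (Function.update w i v) = ψ v := by
  let G : (Fin n → ℂ) [⋀^(Σ i, Fin (k i))]→ₗ[ℂ] ℂ :=
    (Matrix.detRowAlternating (n := Fin n) (R := ℂ)).domDomCongr e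
  have hG : ∀ w, catDet e w = G (fun x => w x.1 x.2) := fun w => rfl
  have hu : ∀ (v : Fin (k i) → Fin n → ℂ) (j : Fin (k i)) (x : Fin n → ℂ),
      (fun y : (Σ i, Fin (k i)) => Function.update w i (Function.update v j x) y.1 y.2) =
      Function.update (fun y : (Σ i, Fin (k i)) => Function.update w i v y.1 y.2) ⟨i, j⟩ x := by
    intro v j x
    funext ⟨i', j'⟩
    by_cases h : i' = i
    · subst h
      by_cases h' : j' = j
      · subst h'; simp
      · rw [Function.update_of_ne (a := (⟨i', j'⟩ : Σ i, Fin (k i))) (a' := ⟨i', j⟩)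
          (by simpa using h')]
        simp [h']
    · rw [Function.update_of_ne (a := (⟨i', j'⟩ : Σ i, Fin (k i))) (a' := ⟨i, j⟩)
        (by intro hh; exact h (congrArg Sigma.fst hh))]
      simp [h]
  refine ⟨{ toFun := fun v => G (fun y => Function.update w i v y.1 y.2)
            map_update_add' := ?_
            map_update_smul' := ?_
            map_eq_zero_of_eq' := ?_ }, fun v => rfl⟩
  · intro inst v j x y
    have : inst = instDecidableEqFin _ := Subsingleton.elim _ _
    subst this
    rw [hu, hu, hu, AlternatingMap.map_update_add]
  · intro inst v j c x
    have : inst = instDecidableEqFin _ := Subsingleton.elim _ _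
    subst this
    rw [hu, hu, AlternatingMap.map_update_smul]
  · intro v a b hab hne
    apply G.map_eq_zero_of_eq (i := ⟨i, a⟩) (j := ⟨i, b⟩)
    · simpa using hab
    · simpa using hne

lemma genW_eq {n l : ℕ} {k : Fin l → ℕ} (e : Fin n ≃ (Σ i, Fin (k i)))
    (he : ∀ f : (∀ i, Fin (k i) → Fin n),
      (List.ofFn fun i => List.ofFn (f i)).flatten = List.ofFn fun a => f (e a).1 (e a).2)
    (S : ∀ i, {s : Finset (Fin n) // s.card = k i}) :
    genW n l k S = catDet e (fun i => eb (S i)) := by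
  rw [catDet, ← Matrix.det_transpose, Matrix.det_apply']
  simp only [genW]
  refine Finset.sum_congr rfl fun π _ => ?_
  have h1 : (List.ofFn fun i => (S i).1.sort (· ≤ ·)).flatten =
      List.ofFn fun a => en (S (e a).1) (e a).2 := by
    simp only [sort_eq]
    exact he (fun i => en (S i))
  rw [h1]
  simp only [Matrix.transpose_apply, Matrix.of_apply, eb, Pi.single_apply]
  rw [Finset.prod_ite_zero]
  simp only [List.ofFn_inj, funext_iff]
  simp

lemma genW_dot {n l : ℕ} {k : Fin l → ℕ} (e : Fin n ≃ (Σ i, Fin (k i)))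
    (he : ∀ f : (∀ i, Fin (k i) → Fin n),
      (List.ofFn fun i => List.ofFn (f i)).flatten = List.ofFn fun a => f (e a).1 (e a).2)
    (w : ∀ i, Fin (k i) → Fin n → ℂ) :
    genW n l k ⬝ᵥ (fun S => ∏ i, eps (S i) (w i)) = catDet e w := by
  rw [multi_expand n l k (catDet e) (catDet_alt e) w]
  simp only [dotProduct, genW_eq e he]

lemma catDet_zero_iff {n l : ℕ} {k : Fin l → ℕ} (e : Fin n ≃ (Σ i, Fin (k i)))
    (w : ∀ i, Fin (k i) → Fin n → ℂ) :
    catDet e w = 0 ↔ (⨆ i, Submodule.span ℂ (Set.range (w i))) ≠ ⊤ := by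
  have h1 : (⨆ i, Submodule.span ℂ (Set.range (w i))) =
      Submodule.span ℂ (Set.range fun a => w (e a).1 (e a).2) := by
    rw [← Submodule.span_iUnion]
    congr 1
    ext x
    simp only [Set.mem_iUnion, Set.mem_range]
    constructor
    · rintro ⟨i, j, rfl⟩
      exact ⟨e.symm ⟨i, j⟩, by rw [Equiv.apply_symm_apply]⟩
    · rintro ⟨a, rfl⟩
      exact ⟨_, _, rfl⟩
  rw [h1, ne_eq, ← not_iff_not, not_not]
  have h2 : catDet e w ≠ 0 ↔ LinearIndependent ℂ (fun a => w (e a).1 (e a).2) := by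
    have := Matrix.linearIndependent_rows_iff_isUnit
      (A := (Matrix.of fun a b : Fin n => w (e a).1 (e a).2 b))
    rw [Matrix.isUnit_iff_isUnit_det, isUnit_iff_ne_zero] at this
    exact this.symm
  rw [← ne_eq, h2]
  constructor
  · intro h
    exact h.span_eq_top_of_card_eq_finrank' (by simp)
  · intro h
    exact linearIndependent_of_top_le_span_of_card_eq_finrank h.ge (by simp)

/-- single summand of `genA` -/
noncomputable def opA (n l : ℕ) (k : Fin l → ℕ) (A : Fin l → Matrix (Fin n) (Fin n) ℂ) (i : Fin l) :
    Matrix (∀ i, {s : Finset (Fin n) // s.card = k i})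
      (∀ i, {s : Finset (Fin n) // s.card = k i}) ℂ :=
  Matrix.of fun S T => lamDer n (k i) (A i) (S i) (T i) *
      ∏ j ∈ Finset.univ.erase i, (if S j = T j then (1 : ℂ) else 0)

lemma genA_eq (n l : ℕ) (k : Fin l → ℕ) (A : Fin l → Matrix (Fin n) (Fin n) ℂ) :
    genA n l k A = ∑ i, opA n l k A i := by
  ext S T
  simp [genA, opA, Matrix.sum_apply]

lemma opA_mulVec (n l : ℕ) (k : Fin l → ℕ) (A : Fin l → Matrix (Fin n) (Fin n) ℂ) (i : Fin l)
    (u : (∀ i, {s : Finset (Fin n) // s.card = k i}) → ℂ)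
    (S : ∀ i, {s : Finset (Fin n) // s.card = k i}) :
    (opA n l k A i).mulVec u S = ∑ t, lamDer n (k i) (A i) (S i) t * u (Function.update S i t) := by
  simp only [Matrix.mulVec, dotProduct, opA, Matrix.of_apply]
  symm
  apply Finset.sum_of_injOn (fun t => Function.update S i t)
  · intro a _ b _ h
    exact Function.update_injective S i h
  · simp
  · intro T _ hT
    have : ∃ j ∈ Finset.univ.erase i, S j ≠ T j := by
      by_contra! hc
      apply hT
      refine ⟨T i, by simp, ?_⟩
      funext j
      by_cases h : j = i
      · subst h; simp
      · simp only [Function.update_of_ne h]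
        exact hc j (by simp [h])
    obtain ⟨j, hj, hne⟩ := this
    rw [Finset.prod_eq_zero hj (by simp [hne])]
    simp
  · intro t _
    rw [Finset.prod_eq_one]
    · simp
    · intro j hj
      rw [Function.update_of_ne (Finset.ne_of_mem_erase hj)]
      simp

lemma opA_comm (n l : ℕ) (k : Fin l → ℕ) (A : Fin l → Matrix (Fin n) (Fin n) ℂ) (i j : Fin l)
    (u : (∀ i, {s : Finset (Fin n) // s.card = k i}) → ℂ) :
    (opA n l k A i).mulVec ((opA n l k A j).mulVec u) =
      (opA n l k A j).mulVec ((opA n l k A i).mulVec u) := by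
  by_cases hij : i = j
  · subst hij; rfl
  funext S
  simp only [opA_mulVec, Finset.mul_sum]
  rw [Finset.sum_comm]
  refine Finset.sum_congr rfl fun t _ => Finset.sum_congr rfl fun t' _ => ?_
  rw [Function.update_of_ne hij, Function.update_of_ne (Ne.symm hij), Function.update_comm hij]
  ring

/-- pure tensors of good families are eigenvectors -/
lemma genA_eig (n l : ℕ) (k : Fin l → ℕ) (A : Fin l → Matrix (Fin n) (Fin n) ℂ)
    (w : ∀ i, Fin (k i) → Fin n → ℂ) (μ : Fin l → ℂ)
    (h : ∀ i, ∀ ψ : (Fin n → ℂ) [⋀^Fin (k i)]→ₗ[ℂ] ℂ,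
      ∑ j, ψ (Function.update (w i) j ((A i).mulVec (w i j))) = μ i * ψ (w i)) :
    (genA n l k A).mulVec (fun S => ∏ i, eps (S i) (w i)) =
      (∑ i, μ i) • (fun S => ∏ i, eps (S i) (w i)) := by
  rw [genA_eq, Matrix.sum_mulVec, Finset.sum_smul]
  refine Finset.sum_congr rfl fun i _ => ?_
  funext S
  rw [opA_mulVec]
  have h1 : ∀ t, ∏ j, eps (Function.update S i t j) (w j) =
      eps t (w i) * ∏ j ∈ Finset.univ.erase i, eps (S j) (w j) := by
    intro t
    rw [← Finset.mul_prod_erase Finset.univ _ (Finset.mem_univ i)]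
    congr 1
    · simp
    · refine Finset.prod_congr rfl fun j hj => ?_
      rw [Function.update_of_ne (Finset.ne_of_mem_erase hj)]
  simp only [h1, ← mul_assoc]
  rw [← Finset.sum_mul, lamDer_eps, h i (eps (S i))]
  simp only [Pi.smul_apply, smul_eq_mul]
  rw [← Finset.mul_prod_erase Finset.univ _ (Finset.mem_univ i)]
  ring

lemma exists_eps_ne {n k : ℕ} (w : Fin k → Fin n → ℂ) (hw : LinearIndependent ℂ w) :
    ∃ S, eps S w ≠ 0 := by
  by_contra! hc
  obtain ⟨g, hg⟩ := LinearMap.exists_leftInverse_of_injective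
    (Fintype.linearCombination ℂ w) (LinearMap.ker_eq_bot.2 hw.fintypeLinearCombination_injective)
  let ψ := (Matrix.detRowAlternating (n := Fin k) (R := ℂ)).compLinearMap g
  have h1 : ψ w = 1 := by
    change Matrix.det (fun q => g (w q)) = 1
    rw [← Matrix.det_one (n := Fin k) (R := ℂ)]
    congr 1
    funext q
    have := LinearMap.congr_fun hg (Pi.single q 1)
    simp only [LinearMap.comp_apply, LinearMap.id_apply] at this
    rw [Fintype.linearCombination_apply_single, one_smul] at this
    rw [this]
    funext p
    simp [Matrix.one_apply, Pi.single_apply, eq_comm]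
  rw [expand] at h1
  simp [hc] at h1

lemma tensor_ne {n l : ℕ} {k : Fin l → ℕ} (w : ∀ i, Fin (k i) → Fin n → ℂ)
    (hw : ∀ i, LinearIndependent ℂ (w i)) :
    (fun S : (∀ i, {s : Finset (Fin n) // s.card = k i}) => ∏ i, eps (S i) (w i)) ≠ 0 := by
  choose S hS using fun i => exists_eps_ne (w i) (hw i)
  intro h
  exact Finset.prod_ne_zero_iff.2 (fun i _ => hS i) (congrFun h S)

lemma trace_prop {n k : ℕ} (B : Matrix (Fin n) (Fin n) ℂ) (w : Fin k → Fin n → ℂ)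
    (h : ∀ i, B.mulVec (w i) ∈ Submodule.span ℂ (Set.range w)) :
    ∃ μ : ℂ, ∀ ψ : (Fin n → ℂ) [⋀^Fin k]→ₗ[ℂ] ℂ,
      ∑ j, ψ (Function.update w j (B.mulVec (w j))) = μ * ψ w := by
  simp only [Submodule.mem_span_range_iff_exists_fun] at h
  choose c hc using h
  refine ⟨∑ j, c j j, fun ψ => ?_⟩
  rw [Finset.sum_mul]
  refine Finset.sum_congr rfl fun j _ => ?_
  rw [← hc j, AlternatingMap.map_update_sum, Finset.sum_eq_single j]
  · rw [AlternatingMap.map_update_smul]; simp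
  · intro p _ hp
    rw [AlternatingMap.map_update_smul, AlternatingMap.map_update_self _ _ hp.symm, smul_zero]
  · simp

lemma lam_eigen {n k : ℕ} (B : Matrix (Fin n) (Fin n) ℂ) (μ : ℂ)
    (x : {s : Finset (Fin n) // s.card = k} → ℂ) (hx : x ≠ 0)
    (h : (lamDer n k B).mulVec x = μ • x) :
    ∃ w : Fin k → Fin n → ℂ, LinearIndependent ℂ w ∧
      (∀ i, B.mulVec (w i) ∈ Submodule.span ℂ (Set.range w)) ∧
      ∀ ψ : (Fin n → ℂ) [⋀^Fin k]→ₗ[ℂ] ℂ,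
        ∑ j, ψ (Function.update w j (B.mulVec (w j))) = μ * ψ w := by
  have h1 : (lamDer n k B - Matrix.scalar _ μ).det = 0 := by
    rw [← Matrix.exists_mulVec_eq_zero_iff]
    refine ⟨x, hx, ?_⟩
    rw [Matrix.sub_mulVec, h, Matrix.scalar_apply, ← Matrix.smul_one_eq_diagonal,
      Matrix.smul_mulVec, Matrix.one_mulVec, sub_self]
  rw [← Matrix.exists_vecMul_eq_zero_iff] at h1
  obtain ⟨y, hy, hy0⟩ := h1
  rw [Matrix.vecMul_sub, Matrix.scalar_apply, ← Matrix.smul_one_eq_diagonal,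
      Matrix.vecMul_smul, Matrix.vecMul_one, sub_eq_zero] at hy0
  let φ : (Fin n → ℂ) [⋀^Fin k]→ₗ[ℂ] ℂ := ∑ S, y S • eps S
  have hφ : ∀ w, φ w = ∑ S, y S * eps S w := by
    intro w
    simp [φ, alt_sum_apply]
  obtain ⟨w, -, h2, h3, h4⟩ := eigen_sub (Matrix.toLin' B) n ⊤ (by simp) (by simp) k φ μ (by
      obtain ⟨T, hT⟩ := Function.ne_iff.1 hy
      refine ⟨eb T, by simp, ?_⟩
      rw [hφ]
      simpa [eps_eb] using hT) (by
      intro w _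
      simp only [hφ, Matrix.toLin'_apply]
      rw [Finset.sum_comm]
      simp only [← Finset.mul_sum, ← lamDer_eps]
      simp only [Finset.mul_sum]
      rw [Finset.sum_comm]
      refine Finset.sum_congr rfl fun T _ => ?_
      have := congrFun hy0 T
      simp only [Matrix.vecMul, dotProduct, Pi.smul_apply, smul_eq_mul] at this
      rw [← mul_assoc, ← this, Finset.sum_mul]
      exact Finset.sum_congr rfl fun S _ => by ring)
  exact ⟨w, h2, h3, h4⟩

lemma pow_eig {ι : Type*} [Fintype ι] [DecidableEq ι] (M : Matrix ι ι ℂ) (v : ι → ℂ) (μ : ℂ)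
    (h : M.mulVec v = μ • v) (m : ℕ) : (M ^ m).mulVec v = μ ^ m • v := by
  induction m with
  | zero => simp
  | succ m ih => rw [pow_succ, ← Matrix.mulVec_mulVec, h, Matrix.mulVec_smul, ih, smul_smul, pow_succ']

lemma exists_eig {ι : Type*} [Fintype ι] [DecidableEq ι] (M : Matrix ι ι ℂ) (r u : ι → ℂ)
    (hu : u ≠ 0) (h : ∀ m < Fintype.card ι, r ⬝ᵥ (M ^ m).mulVec u = 0) :
    ∃ (v : ι → ℂ) (μ : ℂ), v ≠ 0 ∧ M.mulVec v = μ • v ∧ r ⬝ᵥ v = 0 := by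
  have h' : ∀ m, r ⬝ᵥ (M ^ m).mulVec u = 0 := by
    intro m
    have hι : Nonempty ι := by
      by_contra hc
      rw [not_nonempty_iff] at hc
      exact hu (Subsingleton.elim _ _)
    rw [Matrix.pow_eq_aeval_mod_charpoly, Polynomial.aeval_eq_sum_range, Matrix.sum_mulVec,
      dotProduct_sum]
    refine Finset.sum_eq_zero fun i hi => ?_
    rw [Matrix.smul_mulVec, dotProduct_smul, h i, smul_zero]
    have := Polynomial.natDegree_modByMonic_lt (Polynomial.X ^ m) M.charpoly_monic (by
      intro h1
      have := M.charpoly_natDegree_eq_dim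
      rw [h1, Polynomial.natDegree_one] at this
      exact Fintype.card_ne_zero this.symm)
    rw [M.charpoly_natDegree_eq_dim] at this
    have := Finset.mem_range.1 hi
    omega
  let N : Submodule ℂ (ι → ℂ) :=
    { carrier := {v | ∀ m, r ⬝ᵥ (M ^ m).mulVec v = 0}
      add_mem' := by
        intro a b ha hb m
        rw [Matrix.mulVec_add, dotProduct_add, ha m, hb m, add_zero]
      zero_mem' := by intro m; simp
      smul_mem' := by
        intro c a ha m
        rw [Matrix.mulVec_smul, dotProduct_smul, ha m, smul_zero] }
  have hN : ∀ v ∈ N, Matrix.toLin' M v ∈ N := by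
    intro v hv m
    rw [Matrix.toLin'_apply, Matrix.mulVec_mulVec, ← pow_succ]
    exact hv (m+1)
  have : Nontrivial N := ⟨⟨⟨u, h'⟩, 0, fun hc => hu (congrArg Subtype.val hc)⟩⟩
  obtain ⟨μ, hμ⟩ := Module.End.exists_eigenvalue ((Matrix.toLin' M).restrict hN)
  obtain ⟨v, hv⟩ := hμ.exists_hasEigenvector
  refine ⟨v, μ, fun hc => hv.2 (Subtype.ext hc), ?_, ?_⟩
  · have := congrArg Subtype.val hv.apply_eq_smul
    simpa using this
  · simpa using v.2 0

lemma simple_eig {ι : Type*} [Fintype ι] [DecidableEq ι] (M : Matrix ι ι ℂ)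
    (hsq : Squarefree M.charpoly) (v x : ι → ℂ) (μ : ℂ) (hv : v ≠ 0)
    (h : M.mulVec v = μ • v) (hx : M.mulVec x = μ • x) : ∃ c : ℂ, x = c • v := by
  have h1 : Module.finrank ℂ (Module.End.eigenspace (Matrix.toLin' M) μ) ≤ 1 := by
    calc _ ≤ Module.finrank ℂ (Module.End.maxGenEigenspace (Matrix.toLin' M) μ) :=
          Submodule.finrank_mono (Module.End.genEigenspace_le_maximal (Matrix.toLin' M) μ 1)
      _ = _ := LinearMap.finrank_maxGenEigenspace_eq _ _
      _ ≤ 1 := by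
        rw [Matrix.charpoly_toLin']
        exact Polynomial.rootMultiplicity_le_one_of_separable
          (PerfectField.separable_iff_squarefree.2 hsq) μ
  have hv' : v ∈ Module.End.eigenspace (Matrix.toLin' M) μ := by
    rw [Module.End.mem_eigenspace_iff]; simpa using h
  have hx' : x ∈ Module.End.eigenspace (Matrix.toLin' M) μ := by
    rw [Module.End.mem_eigenspace_iff]; simpa using hx
  have h2 := finrank_eq_one_iff_of_nonzero' (K := ℂ) (⟨v, hv'⟩ : Module.End.eigenspace (Matrix.toLin' M) μ)
    (fun hc => hv (congrArg Subtype.val hc))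
  have h3 : Module.finrank ℂ (Module.End.eigenspace (Matrix.toLin' M) μ) = 1 := by
    apply le_antisymm h1
    have : Nontrivial (Module.End.eigenspace (Matrix.toLin' M) μ) :=
      ⟨⟨⟨v, hv'⟩, 0, fun hc => hv (congrArg Subtype.val hc)⟩⟩
    exact Module.finrank_pos
  obtain ⟨c, hc⟩ := h2.1 h3 ⟨x, hx'⟩
  exact ⟨c, (congrArg Subtype.val hc).symm⟩

/-- (i) if there are subspaces `V_i ⊆ ℂⁿ` with `dim V_i = k_i`,
`A_i V_i ⊆ V_i`, whose sum is not all of `ℂⁿ`, then `P = 0`; (ii) conversely, if the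
characteristic polynomial of `A` has no repeated roots (is squarefree) and `P = 0`,
then such subspaces exist. -/
theorem stmt13 (n l : ℕ) (hn : 1 ≤ n) (hl : 1 ≤ l) (k : Fin l → ℕ)
    (hk : ∀ i, 1 ≤ k i) (hsum : ∑ i, k i = n)
    (A : Fin l → Matrix (Fin n) (Fin n) ℂ) :
    ((∃ V : Fin l → Submodule ℂ (Fin n → ℂ),
        (∀ i, Module.finrank ℂ ↥(V i) = k i) ∧
        (∀ i, ∀ x ∈ V i, (A i).mulVec x ∈ V i) ∧
        (⨆ i, V i) ≠ ⊤) →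
      genP n l k A = 0) ∧
    (Squarefree (genA n l k A).charpoly → genP n l k A = 0 →
      ∃ V : Fin l → Submodule ℂ (Fin n → ℂ),
        (∀ i, Module.finrank ℂ ↥(V i) = k i) ∧
        (∀ i, ∀ x ∈ V i, (A i).mulVec x ∈ V i) ∧
        (⨆ i, V i) ≠ ⊤) := by
  obtain ⟨e, he⟩ := exists_cat n l k hsum
  constructor
  · rintro ⟨V, hV, hinv, htop⟩
    let b := fun i => Module.finBasisOfFinrankEq ℂ (V i) (hV i)
    let w : ∀ i, Fin (k i) → Fin n → ℂ := fun i j => (b i j : Fin n → ℂ)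
    have hspan : ∀ i, Submodule.span ℂ (Set.range (w i)) = V i := by
      intro i
      have h1 : Set.range (w i) = (V i).subtype '' Set.range (b i) := by
        rw [← Set.range_comp]; rfl
      rw [h1, Submodule.span_image, (b i).span_eq]
      simp
    have hli : ∀ i, LinearIndependent ℂ (w i) := fun i =>
      (b i).linearIndependent.map' (V i).subtype (by simp)
    have htr := fun i => trace_prop (A i) (w i) (fun j => by
      rw [hspan]; exact hinv i _ (b i j).2)
    choose μ hμ using htr
    have heig := genA_eig n l k A w μ hμ
    have hdot := genW_dot e he w
    rw [(catDet_zero_iff e w).2 (by simpa only [hspan] using htop)] at hdot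
    rw [genP, ← Matrix.exists_mulVec_eq_zero_iff]
    refine ⟨_, tensor_ne w hli, ?_⟩
    funext S
    change Matrix.vecMul _ _ ⬝ᵥ _ = 0
    rw [← Matrix.dotProduct_mulVec, pow_eig _ _ _ heig, dotProduct_smul, hdot, smul_zero]
  · intro hsq hP
    rw [genP, ← Matrix.exists_mulVec_eq_zero_iff] at hP
    obtain ⟨u, hu, hMu⟩ := hP
    obtain ⟨v, μ, hv, hAv, hwv⟩ := exists_eig (genA n l k A) (genW n l k) u hu (by
      intro m hm
      have h1 := congrFun hMu ((Fintype.equivFin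
        (∀ i, {s : Finset (Fin n) // s.card = k i})).symm ⟨m, hm⟩)
      change Matrix.vecMul _ _ ⬝ᵥ _ = 0 at h1
      rw [← Matrix.dotProduct_mulVec] at h1
      simpa using h1)
    have hop : ∀ i, ∃ c : ℂ, (opA n l k A i).mulVec v = c • v := by
      intro i
      apply simple_eig _ hsq v _ μ hv hAv
      rw [← Matrix.mulVec_smul, ← hAv, genA_eq, Matrix.sum_mulVec, Matrix.sum_mulVec,
        Matrix.mulVec_sum]
      exact Finset.sum_congr rfl fun j _ => opA_comm n l k A j i v
    choose c hc using hop
    obtain ⟨S, hS⟩ := Function.ne_iff.1 hv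
    have hw := fun i => lam_eigen (A i) (c i) (fun t => v (Function.update S i t))
      (by
        intro h0
        apply hS
        have := congrFun h0 (S i)
        simpa using this) (by
        funext t
        have := congrFun (hc i) (Function.update S i t)
        rw [opA_mulVec] at this
        simpa [Matrix.mulVec, dotProduct] using this)
    choose w hli hinv htr using hw
    have heig := genA_eig n l k A w c htr
    have hsumc : ∑ i, c i = μ := by
      have h1 : (∑ i, c i) • v = μ • v := by
        rw [← hAv, genA_eq, Matrix.sum_mulVec, Finset.sum_smul]
        exact Finset.sum_congr rfl fun i _ => (hc i).symm
      exact smul_left_injective ℂ hv h1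
    rw [hsumc] at heig
    obtain ⟨a, ha⟩ := simple_eig _ hsq v _ μ hv hAv heig
    have hdot := genW_dot e he w
    rw [ha, dotProduct_smul, hwv, smul_zero] at hdot
    refine ⟨fun i => Submodule.span ℂ (Set.range (w i)), ?_, ?_, (catDet_zero_iff e w).1 hdot.symm⟩
    · intro i
      rw [finrank_span_eq_card (hli i)]; simp
    · intro i x hx
      have : Submodule.span ℂ (Set.range (w i)) ≤
          (Submodule.span ℂ (Set.range (w i))).comap (Matrix.toLin' (A i)) := by
        rw [Submodule.span_le]
        rintro _ ⟨j, rfl⟩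
        simpa using hinv i j
      simpa using this hx
end
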